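/- arXiv:0906.4581 — 6 statements merged into one kernel-verified Lean document; each statement's English description precedes it below -/
import Mathlib

section
/- Let f : ℝ² → ℝ² be a homeomorphism admitting a Lyapunov function U. Then f is U-expansive: for any two distinct points x, y ∈ ℝ² and any k > 0 there exists n ∈ ℤ such that U(fⁿ(x), fⁿ(y)) > k. -/
/-- The plane. -/
abbrev Plane : Type := ℝ × ℝ

/-- First difference of `U` along `f`. -/
def Vd (f : Plane → Plane) (U : Plane → Plane → ℝ) (x y : Plane) : ℝ :=
  U (f x) (f y) - U x y

/-- Second difference of `U` along `f`. -/
def Wd (f : Plane → Plane) (U : Plane → Plane → ℝ) (x y : Plane) : ℝ :=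
  Vd f U (f x) (f y) - Vd f U x y

/-- `U` is a Lyapunov function for `f`: continuous, nonnegative, vanishing exactly on the
diagonal, and with positive second difference off the diagonal. -/
def IsLyapunov (f : Plane → Plane) (U : Plane → Plane → ℝ) : Prop :=
  Continuous (fun p : Plane × Plane => U p.1 p.2) ∧
  (∀ x y, 0 ≤ U x y) ∧
  (∀ x y, U x y = 0 ↔ x = y) ∧
  (∀ x y, x ≠ y → 0 < Wd f U x y)

/-- The `n`-th iterate of a homeomorphism `f`, for `n : ℤ` (negative `n` uses the inverse). -/
def iterZ (f : Plane ≃ₜ Plane) (n : ℤ) : Plane → Plane :=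
  ⇑(f.toEquiv ^ n)

/-- A homeomorphism of the plane admitting a Lyapunov function `U` is `U`-expansive: for any
two distinct points `x, y` and any `k > 0` there is `n : ℤ` with `U (fⁿ x) (fⁿ y) > k`. -/
theorem expansive_of_lyapunov (f : Plane ≃ₜ Plane) (U : Plane → Plane → ℝ)
    (hU : IsLyapunov (⇑f) U) :
    ∀ x y : Plane, x ≠ y → ∀ k : ℝ, 0 < k →
      ∃ n : ℤ, k < U (iterZ f n x) (iterZ f n y) := by
  intro x y hxy k hk
  obtain ⟨-, h0, -, hW⟩ := hU
  set u : ℤ → ℝ := fun n => U (iterZ f n x) (iterZ f n y) with hu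
  have hs : ∀ (n : ℤ) (z : Plane), iterZ f (n + 1) z = f (iterZ f n z) := by
    intro n z
    unfold iterZ
    rw [add_comm, zpow_add, zpow_one]
    rfl
  have hne : ∀ n : ℤ, iterZ f n x ≠ iterZ f n y := fun n h =>
    hxy ((f.toEquiv ^ n).injective h)
  have hc : ∀ n : ℤ, u (n + 1) - u n < u (n + 1 + 1) - u (n + 1) := by
    intro n
    have h := hW _ _ (hne n)
    simp only [Wd, Vd, ← hs] at h
    simp only [hu]
    linarith
  have hu0 : 0 ≤ u 0 := h0 _ _
  have key : ∃ n : ℤ, k < u n := by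
    by_cases hv : 0 < u 1 - u 0
    · have hv1 : ∀ n : ℕ, u 1 - u 0 ≤ u ((n : ℤ) + 1) - u n := by
        intro n
        induction n with
        | zero => simp
        | succ m ih =>
          have := hc m
          push_cast
          linarith
      have hg : ∀ n : ℕ, (n : ℝ) * (u 1 - u 0) ≤ u n := by
        intro n
        induction n with
        | zero => simpa using hu0
        | succ m ih =>
          have := hv1 m
          push_cast
          linarith
      obtain ⟨n, hn⟩ := exists_nat_gt (k / (u 1 - u 0))
      rw [div_lt_iff₀ hv] at hn
      exact ⟨n, hn.trans_le (hg n)⟩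
    · have hd : 0 < u (-1) - u 0 := by
        have := hc (-1)
        norm_num at this
        linarith
      have hv1 : ∀ n : ℕ, u (-1) - u 0 ≤ u (-(n : ℤ) - 1) - u (-(n : ℤ)) := by
        intro n
        induction n with
        | zero => simp
        | succ m ih =>
          have h := hc (-(m : ℤ) - 1 - 1)
          have e1 : -((m + 1 : ℕ) : ℤ) = -(m : ℤ) - 1 := by push_cast; ring
          rw [e1]
          simp only [sub_add_cancel] at h
          linarith
      have hg : ∀ n : ℕ, (n : ℝ) * (u (-1) - u 0) ≤ u (-(n : ℤ)) := by
        intro n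
        induction n with
        | zero => simpa using hu0
        | succ m ih =>
          have h := hv1 m
          have e1 : -((m + 1 : ℕ) : ℤ) = -(m : ℤ) - 1 := by push_cast; ring
          rw [e1]
          push_cast
          linarith
      obtain ⟨n, hn⟩ := exists_nat_gt (k / (u (-1) - u 0))
      rw [div_lt_iff₀ hd] at hn
      exact ⟨-(n : ℤ), hn.trans_le (hg n)⟩
  exact key
end

section
/- Let f : ℝ² → ℝ² be a homeomorphism admitting a Lyapunov function U satisfying the sign condition. Then no point of ℝ² is a stable point of f and no point of ℝ² is an unstable point of f. -/
/-- The ball `B_k(x) = { y : U x y ≤ k }`. -/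
def Bk (U : Plane → Plane → ℝ) (k : ℝ) (x : Plane) : Set Plane :=
  {y | U x y ≤ k}

/-- Sign condition: on the boundary of each ball `B_k(x)` there are points where the first
difference is positive and points where it is negative. -/
def SignCondition (f : Plane → Plane) (U : Plane → Plane → ℝ) : Prop :=
  ∀ x : Plane, ∀ k : ℝ, 0 < k →
    (∃ y, U x y = k ∧ 0 < Vd f U x y) ∧ (∃ z, U x z = k ∧ Vd f U x z < 0)

/-- `x` is a stable point for `g` (applied to `g = f` for stability and `g = f⁻¹` for
instability): for every `k' > 0` there is `k > 0` such that every `y ∈ B_k(x)` satisfies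
`U (gⁿ x) (gⁿ y) < k'` for all `n ≥ 0`. -/
def IsStablePoint (g : Plane → Plane) (U : Plane → Plane → ℝ) (x : Plane) : Prop :=
  ∀ k' : ℝ, 0 < k' → ∃ k : ℝ, 0 < k ∧
    ∀ y ∈ Bk U k x, ∀ n : ℕ, U (g^[n] x) (g^[n] y) < k'

theorem grow_aux (a : ℕ → ℝ) (h1 : 0 < a 1 - a 0) (h0 : 0 ≤ a 0)
    (h2 : ∀ n, a (n+1) - a n ≤ a (n+2) - a (n+1)) (K : ℝ) : ∃ n, K ≤ a n := by
  have hd : ∀ n, a 1 - a 0 ≤ a (n+1) - a n := by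
    intro n
    induction n with
    | zero => exact le_refl _
    | succ n ih => exact ih.trans (h2 n)
  have hl : ∀ n : ℕ, (n : ℝ) * (a 1 - a 0) ≤ a n := by
    intro n
    induction n with
    | zero => simpa using h0
    | succ n ih =>
      have := hd n
      push_cast
      linarith
  obtain ⟨n, hn⟩ := exists_nat_ge (K / (a 1 - a 0))
  exact ⟨n, ((div_le_iff₀ h1).1 hn).trans (hl n)⟩

/-- The sign condition implies the non-existence of stable points and of unstable points. -/
theorem no_stable_or_unstable_points (f : Plane ≃ₜ Plane) (U : Plane → Plane → ℝ)
    (hU : IsLyapunov (⇑f) U) (hsign : SignCondition (⇑f) U) :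
    ∀ x : Plane, ¬ IsStablePoint (⇑f) U x ∧ ¬ IsStablePoint (⇑f.symm) U x := by
  obtain ⟨-, hpos, hzero, hW⟩ := hU
  simp only [Wd, Vd] at hW
  intro x
  constructor
  · intro hs
    obtain ⟨k, hk, h⟩ := hs 1 one_pos
    obtain ⟨⟨y, hy, hV⟩, -⟩ := hsign x k hk
    have hxy : x ≠ y := fun e => by
      have := (hzero x y).2 e
      linarith
    obtain ⟨n, hn⟩ := grow_aux (fun n => U (f^[n] x) (f^[n] y)) (by simpa [Vd] using hV)
      (hpos _ _) (fun n => by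
        have := hW _ _ ((f.injective.iterate n).ne hxy)
        simp only [Function.iterate_succ_apply']
        linarith) 1
    exact absurd (h y (le_of_eq hy) n) (not_lt.2 hn)
  · intro hs
    obtain ⟨k, hk, h⟩ := hs 1 one_pos
    obtain ⟨-, ⟨y, hy, hV⟩⟩ := hsign x k hk
    have hxy : x ≠ y := fun e => by
      have := (hzero x y).2 e
      linarith
    obtain ⟨n, hn⟩ := grow_aux (fun n => U (f.symm^[n] x) (f.symm^[n] y)) (by
        have := hW _ _ (f.symm.injective.ne hxy)
        simp only [Vd] at hV
        simp only [Homeomorph.apply_symm_apply] at this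
        simp only [Function.iterate_succ_apply', Function.iterate_zero, id,
          Function.iterate_one]
        linarith)
      (hpos _ _) (fun n => by
        have := hW _ _ ((f.symm.injective.iterate (n+2)).ne hxy)
        simp only [Function.iterate_succ_apply', Homeomorph.apply_symm_apply] at this ⊢
        linarith) 1
    exact absurd (h y (le_of_eq hy) n) (not_lt.2 hn)
end

section
/- Let f : ℝ² → ℝ² be a homeomorphism admitting a Lyapunov metric function U satisfying the sign condition, and let 0 < k′ < k. Then there exists σ > 0 such that for all x, y ∈ ℝ², if y ∈ S_k(x) and U(x,y) < σ, then y ∈ S_{k′}(x). -/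
/-- `U` is a Lyapunov metric function for `f`: a Lyapunov function which is moreover a
metric on the plane inducing the same topology as the usual (Euclidean) metric. -/
def IsLyapunovMetric (f : Plane → Plane) (U : Plane → Plane → ℝ) : Prop :=
  IsLyapunov f U ∧
  (∀ x y, U x y = U y x) ∧
  (∀ x y z, U x z ≤ U x y + U y z) ∧
  (∀ s : Set Plane, IsOpen s ↔ ∀ x ∈ s, ∃ ε : ℝ, 0 < ε ∧ ∀ y, U x y < ε → y ∈ s)

/-- The `k`-stable set `S_k(x)`. -/
def Sk (f : Plane → Plane) (U : Plane → Plane → ℝ) (k : ℝ) (x : Plane) : Set Plane :=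
  {y | ∀ n : ℕ, U (f^[n] x) (f^[n] y) ≤ k}

theorem convex_bdd_antitone (a : ℕ → ℝ) (k : ℝ) (hb : ∀ n, a n ≤ k)
    (hc : ∀ n, a (n+1) - a n ≤ a (n+2) - a (n+1)) (n : ℕ) : a (n+1) ≤ a n := by
  by_contra h
  have h := not_le.mp h
  have h1 : ∀ m, a (n+1) - a n ≤ a (n+m+1) - a (n+m) := by
    intro m
    induction m with
    | zero => simp
    | succ m ih => exact ih.trans (hc (n+m))
  have h2 : ∀ m : ℕ, a n + m * (a (n+1) - a n) ≤ a (n+m) := by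
    intro m
    induction m with
    | zero => simp
    | succ m ih =>
      have := h1 m
      push_cast
      rw [← add_assoc]
      linarith
  obtain ⟨m, hm⟩ := exists_nat_gt ((k - a n) / (a (n+1) - a n))
  rw [div_lt_iff₀ (by linarith)] at hm
  have := h2 m
  have := hb (n+m)
  linarith

/-- For `0 < k' < k` there is `σ > 0` such that any point of `S_k(x)` at `U`-distance less
than `σ` from `x` lies in `S_{k'}(x)`. -/
theorem stable_set_shrinking (f : Plane ≃ₜ Plane) (U : Plane → Plane → ℝ)
    (hU : IsLyapunovMetric (⇑f) U) (hsign : SignCondition (⇑f) U)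
    (k' k : ℝ) (hk' : 0 < k') (hkk : k' < k) :
    ∃ σ : ℝ, 0 < σ ∧ ∀ x y : Plane,
      y ∈ Sk (⇑f) U k x → U x y < σ → y ∈ Sk (⇑f) U k' x := by
  obtain ⟨⟨_, _, h0, hW⟩, _, _, _⟩ := hU
  refine ⟨k', hk', fun x y hy hxy => ?_⟩
  have hanti := convex_bdd_antitone (fun n => U (f^[n] x) (f^[n] y)) k hy (by
    intro n
    simp only [Function.iterate_succ_apply']
    by_cases h : f^[n] x = f^[n] y
    · simp [h, (h0 _ _).2]
    · have := hW _ _ h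
      simp only [Wd, Vd] at this
      linarith)
  intro n
  have := antitone_nat_of_succ_le (f := fun n => U (f^[n] x) (f^[n] y)) hanti (Nat.zero_le n)
  simp only [Function.iterate_zero, id] at this
  linarith
end

section
/- Let f : ℝ² → ℝ² be a homeomorphism admitting a Lyapunov function U. Then stable and unstable curves intersect each other at most once; concretely, if y, z ∈ ℝ² and there exists k > 0 such that U(fⁿ(y), fⁿ(z)) ≤ k for all n ≥ 0 and also U(fⁿ(y), fⁿ(z)) ≤ k for all n ≤ 0 (i.e., z lies in both the k-stable and the k-unstable set of y), then y = z. -/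
theorem unbdd_aux (a : ℕ → ℝ) (c k : ℝ) (hc : 0 < c) (h : ∀ n, c ≤ a (n+1) - a n)
    (hk : ∀ n, a n ≤ k) : False := by
  have h1 : ∀ n : ℕ, a 0 + n * c ≤ a n := by
    intro n
    induction n with
    | zero => simp
    | succ n ih => push_cast; linarith [h n]
  obtain ⟨n, hn⟩ := exists_nat_gt ((k - a 0) / c)
  rw [div_lt_iff₀ hc] at hn
  linarith [h1 n, hk n]

/-- Stable and unstable curves intersect at most once: if `z` stays `U`-within `k` of `y`
both in forward and in backward time, then `y = z`. -/
theorem stable_unstable_intersect_at_most_once (f : Plane ≃ₜ Plane) (U : Plane → Plane → ℝ)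
    (hU : IsLyapunov (⇑f) U) (y z : Plane) (k : ℝ) (hk : 0 < k)
    (hs : ∀ n : ℕ, U ((⇑f)^[n] y) ((⇑f)^[n] z) ≤ k)
    (hu : ∀ n : ℕ, U ((⇑f.symm)^[n] y) ((⇑f.symm)^[n] z) ≤ k) :
    y = z := by
  obtain ⟨-, -, -, hW⟩ := hU
  by_contra hne
  have hW' : ∀ x y, x ≠ y → Vd f U x y < Vd f U (f x) (f y) := fun x y h => by
    have := hW x y h
    unfold Wd at this
    linarith
  by_cases h0 : 0 ≤ Vd f U y z
  · have h1 := hW' y z hne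
    have hV : ∀ n : ℕ, Vd f U (f y) (f z) ≤ Vd f U (f^[n+1] y) (f^[n+1] z) := by
      intro n
      induction n with
      | zero => simp
      | succ n ih =>
        have := hW' (f^[n+1] y) (f^[n+1] z) ((f.injective.iterate (n+1)).ne hne)
        rw [← Function.iterate_succ_apply' f, ← Function.iterate_succ_apply' f] at this
        linarith
    refine unbdd_aux (fun n => U (f^[n+1] y) (f^[n+1] z)) (Vd f U (f y) (f z)) k
      (by linarith) (fun n => ?_) (fun n => hs (n+1))
    have := hV n
    simp only [Function.iterate_succ_apply' _ (n+1)]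
    exact this
  · have hV : ∀ n : ℕ, Vd f U (f.symm^[n] y) (f.symm^[n] z) ≤ Vd f U y z := by
      intro n
      induction n with
      | zero => simp
      | succ n ih =>
        have := hW' (f.symm^[n+1] y) (f.symm^[n+1] z)
          ((f.symm.injective.iterate (n+1)).ne hne)
        rw [Function.iterate_succ_apply', Function.iterate_succ_apply',
          f.apply_symm_apply, f.apply_symm_apply] at this
        rw [Function.iterate_succ_apply', Function.iterate_succ_apply']
        linarith
    refine unbdd_aux (fun n => U (f.symm^[n] y) (f.symm^[n] z)) (-Vd f U y z) k
      (by linarith) (fun n => ?_) hu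
    have h2 := hV (n+1)
    rw [Vd, Function.iterate_succ_apply', Function.iterate_succ_apply',
      f.apply_symm_apply, f.apply_symm_apply] at h2
    simp only [Function.iterate_succ_apply']
    linarith
end

section
/- Let f : ℝ² → ℝ² be a homeomorphism with a fixed point that admits a Lyapunov metric function U satisfying the sign condition, and suppose f has no singularities (every point has local product structure). If U satisfies property HP, then f is topologically conjugate to a linear hyperbolic automorphism of the plane: there exist a homeomorphism h : ℝ² → ℝ² and an invertible linear map A : ℝ² → ℝ² none of whose complex eigenvalues has modulus 1, such that h(f(x)) = A(h(x)) for all x ∈ ℝ². -/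
/-- The `k`-unstable set `S^u_k(x)`. -/
def Sku (f : Plane ≃ₜ Plane) (U : Plane → Plane → ℝ) (k : ℝ) (x : Plane) : Set Plane :=
  {y | ∀ n : ℕ, U ((⇑f.symm)^[n] x) ((⇑f.symm)^[n] y) ≤ k}

open Set in
/-- `f` has no singularities: every point has local product structure, i.e. there is a
homeomorphism `h` from `[-1,1] × [-1,1]` onto a neighborhood of `x` with `h (0,0) = x`
whose horizontal segments lie in stable sets and whose vertical segments lie in unstable
sets.  (Since the square is compact, a continuous injective map on it is a homeomorphism
onto its image.) -/
def NoSingularities (f : Plane ≃ₜ Plane) (U : Plane → Plane → ℝ) : Prop :=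
  ∀ x : Plane, ∃ k : ℝ, 0 < k ∧ ∃ h : ℝ × ℝ → Plane,
    ContinuousOn h (Icc (-1 : ℝ) 1 ×ˢ Icc (-1 : ℝ) 1) ∧
    InjOn h (Icc (-1 : ℝ) 1 ×ˢ Icc (-1 : ℝ) 1) ∧
    h (0, 0) = x ∧
    h '' (Icc (-1 : ℝ) 1 ×ˢ Icc (-1 : ℝ) 1) ∈ nhds x ∧
    (∀ s ∈ Icc (-1 : ℝ) 1, ∀ t ∈ Icc (-1 : ℝ) 1, h (t, s) ∈ Sk (⇑f) U k (h (0, s))) ∧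
    (∀ t ∈ Icc (-1 : ℝ) 1, ∀ s ∈ Icc (-1 : ℝ) 1, h (t, s) ∈ Sku f U k (h (t, 0)))

/-- Property HP: for every compact set `C` and every `ε > 0`, for all `x` far enough from
the origin and all `y, z ∈ C`, `|V(x,y) - V(x,z)| ≤ ε · W(x,y)`. -/
def PropertyHP (f : Plane → Plane) (U : Plane → Plane → ℝ) : Prop :=
  ∀ C : Set Plane, IsCompact C → ∀ ε : ℝ, 0 < ε → ∃ R : ℝ, 0 < R ∧
    ∀ x : Plane, R < ‖x‖ → ∀ y ∈ C, ∀ z ∈ C,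
      |Vd f U x y - Vd f U x z| ≤ ε * Wd f U x y

namespace CLH
open Set Filter Topology

def St (f : Plane → Plane) (U : Plane → Plane → ℝ) (x y : Plane) : Prop :=
  ∃ K, ∀ n : ℕ, U (f^[n] x) (f^[n] y) ≤ K

variable {f : Plane ≃ₜ Plane} {U : Plane → Plane → ℝ}

lemma U_self (hU : IsLyapunovMetric (⇑f) U) (x : Plane) : U x x = 0 := (hU.1.2.2.1 x x).2 rfl

lemma U_cont (hU : IsLyapunovMetric (⇑f) U) {X : Type*} [TopologicalSpace X] {a b : X → Plane}
    (ha : Continuous a) (hb : Continuous b) : Continuous (fun x => U (a x) (b x)) :=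
  hU.1.1.comp (ha.prodMk hb)

lemma symm_lyap (hU : IsLyapunovMetric (⇑f) U) : IsLyapunovMetric (⇑f.symm) U := by
  refine ⟨⟨hU.1.1, hU.1.2.1, hU.1.2.2.1, ?_⟩, hU.2⟩
  intro x y hxy
  have := hU.1.2.2.2 (f.symm (f.symm x)) (f.symm (f.symm y)) (by simpa using hxy)
  simp only [Wd, Vd, Homeomorph.apply_symm_apply] at this ⊢
  linarith

lemma V_strict (hU : IsLyapunovMetric (⇑f) U) {x y : Plane} (h : x ≠ y) :
    Vd f U x y < Vd f U (f x) (f y) := by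
  have := hU.1.2.2.2 x y h
  unfold Wd at this
  linarith

lemma V_le (hU : IsLyapunovMetric (⇑f) U) (x y : Plane) :
    Vd f U x y ≤ Vd f U (f x) (f y) := by
  by_cases h : x = y
  · subst h; simp [Vd, U_self hU]
  · exact (V_strict hU h).le

lemma V_mono (hU : IsLyapunovMetric (⇑f) U) (x y : Plane) :
    Monotone (fun n : ℕ => Vd f U (f^[n] x) (f^[n] y)) := by
  apply monotone_nat_of_le_succ
  intro n
  simp only [Function.iterate_succ_apply']
  exact V_le hU _ _

lemma St.le (hU : IsLyapunovMetric (⇑f) U) {x y : Plane} (h : St f U x y) :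
    Vd f U x y ≤ 0 := by
  by_contra hc
  push Not at hc
  obtain ⟨K, hK⟩ := h
  have key : ∀ n : ℕ, n * Vd f U x y ≤ U (f^[n] x) (f^[n] y) := by
    intro n
    induction n with
    | zero => simpa using hU.1.2.1 x y
    | succ n ih =>
      have h1 := V_mono hU x y (Nat.zero_le n)
      simp only [Function.iterate_zero, id] at h1
      have h2 : Vd f U (f^[n] x) (f^[n] y) =
        U (f^[n+1] x) (f^[n+1] y) - U (f^[n] x) (f^[n] y) := by
        simp [Vd, Function.iterate_succ_apply']
      push_cast
      linarith
  obtain ⟨n, hn⟩ := exists_nat_gt (K / Vd f U x y)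
  rw [div_lt_iff₀ hc] at hn
  linarith [key n, hK n]

lemma St.map {x y : Plane} (h : St f U x y) : St f U (f x) (f y) := by
  obtain ⟨K, hK⟩ := h
  exact ⟨K, fun n => by simpa [Function.iterate_succ_apply] using hK (n+1)⟩

lemma St.of_map {x y : Plane} (h : St f U (f x) (f y)) : St f U x y := by
  obtain ⟨K, hK⟩ := h
  refine ⟨max K (U x y), fun n => ?_⟩
  cases n with
  | zero => simp
  | succ n => exact le_max_of_le_left (by simpa [Function.iterate_succ_apply] using hK n)

lemma St.map_symm {x y : Plane} (h : St f U x y) : St f U (f.symm x) (f.symm y) :=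
  St.of_map (by simpa using h)

lemma St.map_iter {x y : Plane} (h : St f U x y) (n : ℕ) : St f U (f^[n] x) (f^[n] y) := by
  induction n with
  | zero => simpa
  | succ n ih => simpa only [Function.iterate_succ_apply'] using ih.map

lemma St.lt (hU : IsLyapunovMetric (⇑f) U) {x y : Plane} (h : St f U x y) (hxy : x ≠ y) :
    Vd f U x y < 0 := lt_of_lt_of_le (V_strict hU hxy) (h.map.le hU)

lemma St.U_step (hU : IsLyapunovMetric (⇑f) U) {x y : Plane} (h : St f U x y) :
    U (f x) (f y) ≤ U x y := by
  have := h.le hU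
  unfold Vd at this
  linarith

lemma St.anti (hU : IsLyapunovMetric (⇑f) U) {x y : Plane} (h : St f U x y) :
    Antitone (fun n : ℕ => U (f^[n] x) (f^[n] y)) := by
  apply antitone_nat_of_succ_le
  intro n
  simp only [Function.iterate_succ_apply']
  exact (h.map_iter n).U_step hU

lemma St_iff (hU : IsLyapunovMetric (⇑f) U) {x y : Plane} :
    St f U x y ↔ ∀ n : ℕ, U (f^[n] x) (f^[n] y) ≤ U x y := by
  constructor
  · intro h n
    exact h.anti hU (Nat.zero_le n)
  · intro h; exact ⟨_, h⟩

lemma St_closed (hU : IsLyapunovMetric (⇑f) U) : IsClosed {q : Plane × Plane | St f U q.1 q.2} := by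
  simp only [St_iff hU, ofPred_forall]
  refine isClosed_iInter fun n => isClosed_le ?_ ?_
  · exact U_cont hU ((f.continuous.iterate n).comp continuous_fst)
      ((f.continuous.iterate n).comp continuous_snd)
  · exact U_cont hU continuous_fst continuous_snd

lemma St.refl (hU : IsLyapunovMetric (⇑f) U) (x : Plane) : St f U x x :=
  ⟨0, fun _ => (U_self hU _).le⟩

lemma St.symm (hU : IsLyapunovMetric (⇑f) U) {x y : Plane} (h : St f U x y) : St f U y x := by
  obtain ⟨K, hK⟩ := h
  exact ⟨K, fun n => by rw [hU.2.1]; exact hK n⟩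

lemma St.trans (hU : IsLyapunovMetric (⇑f) U) {x y z : Plane} (h : St f U x y)
    (h' : St f U y z) : St f U x z := by
  obtain ⟨K, hK⟩ := h
  obtain ⟨K', hK'⟩ := h'
  exact ⟨K + K', fun n => (hU.2.2.1 _ _ _).trans (add_le_add (hK n) (hK' n))⟩

lemma Un_pos (hU : IsLyapunovMetric (⇑f) U) {x y : Plane} (h : St f.symm U x y) (hxy : x ≠ y) :
    0 < Vd f U x y := by
  have h1 := h.le (symm_lyap hU)
  have h2 := V_strict hU (x := f.symm x) (y := f.symm y) (by simpa using hxy)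
  simp only [Vd, Homeomorph.apply_symm_apply] at h1 h2 ⊢
  linarith

lemma uniq (hU : IsLyapunovMetric (⇑f) U) {x y : Plane} (h : St f U x y)
    (h' : St f.symm U x y) : x = y := by
  by_contra hc
  linarith [h.lt hU hc, Un_pos hU h' hc]

/-- bracket relation -/
def Br (f : Plane ≃ₜ Plane) (U : Plane → Plane → ℝ) (w x y : Plane) : Prop :=
  St f.symm U w x ∧ St f U w y

lemma Br.uniq (hU : IsLyapunovMetric (⇑f) U) {w w' x y : Plane} (h : Br f U w x y)
    (h' : Br f U w' x y) : w = w' :=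
  CLH.uniq hU (h.2.trans hU (h'.2.symm hU))
    (h.1.trans (symm_lyap hU) (h'.1.symm (symm_lyap hU)))

lemma Br_bdd (hU : IsLyapunovMetric (⇑f) U) (hHP : PropertyHP (⇑f) U) (C : Set Plane)
    (hC : IsCompact C) : ∃ K : Set Plane, IsCompact K ∧ ∀ w, ∀ x ∈ C, ∀ y ∈ C,
      Br f U w x y → w ∈ K := by
  obtain ⟨R, hR, H⟩ := hHP C hC 1 one_pos
  refine ⟨Metric.closedBall 0 R ∪ C, (isCompact_closedBall _ _).union hC, ?_⟩
  intro w x hx y hy hB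
  by_contra hw
  simp only [mem_union, Metric.mem_closedBall, dist_zero_right, not_or, not_le] at hw
  have h1 := H w hw.1 y hy x hx
  have hwx : w ≠ x := fun h => hw.2 (h ▸ hx)
  have hwy : w ≠ y := fun h => hw.2 (h ▸ hy)
  have h2 := hB.2.map.lt hU (by simpa using hwy)
  have h3 := Un_pos hU hB.1 hwx
  have h4 := abs_le.1 h1
  unfold Wd at h4
  linarith

lemma exists_cpt_nhds (x y : Plane) : ∃ C : Set Plane, IsCompact C ∧ C ∈ 𝓝 x ∧ C ∈ 𝓝 y := by
  obtain ⟨A, hA, hA'⟩ := exists_compact_mem_nhds x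
  obtain ⟨B, hB, hB'⟩ := exists_compact_mem_nhds y
  exact ⟨A ∪ B, hA.union hB, mem_of_superset hA' subset_union_left,
    mem_of_superset hB' subset_union_right⟩

lemma Br_lim (hU : IsLyapunovMetric (⇑f) U) {ι : Type*} {l : Filter ι} [l.NeBot]
    {w x y : ι → Plane} {w0 x0 y0 : Plane} (hw : Tendsto w l (𝓝 w0)) (hx : Tendsto x l (𝓝 x0))
    (hy : Tendsto y l (𝓝 y0)) (h : ∀ᶠ i in l, Br f U (w i) (x i) (y i)) : Br f U w0 x0 y0 :=
  ⟨(St_closed (symm_lyap hU)).mem_of_tendsto (hw.prodMk_nhds hx) (h.mono fun _ h => h.1),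
   (St_closed hU).mem_of_tendsto (hw.prodMk_nhds hy) (h.mono fun _ h => h.2)⟩

lemma Br_tendsto (hU : IsLyapunovMetric (⇑f) U) (hHP : PropertyHP (⇑f) U) {ι : Type*}
    {l : Filter ι} {w x y : ι → Plane} {w0 x0 y0 : Plane} (hx : Tendsto x l (𝓝 x0))
    (hy : Tendsto y l (𝓝 y0)) (h : ∀ᶠ i in l, Br f U (w i) (x i) (y i))
    (h0 : Br f U w0 x0 y0) : Tendsto w l (𝓝 w0) := by
  obtain ⟨C, hC, hCx, hCy⟩ := exists_cpt_nhds x0 y0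
  obtain ⟨K, hK, H⟩ := Br_bdd hU hHP C hC
  refine hK.tendsto_nhds_of_unique_mapClusterPt (f := w) ?_ ?_
  · filter_upwards [h, hx hCx, hy hCy] with i h1 h2 h3 using H _ _ h2 _ h3 h1
  · intro z _ hz
    obtain ⟨u, hu, hz⟩ := mapClusterPt_iff_ultrafilter.1 hz
    exact (Br_lim hU hz (hx.mono_left hu) (hy.mono_left hu) (hu h)).uniq hU h0

lemma Br_closed (hU : IsLyapunovMetric (⇑f) U) (hHP : PropertyHP (⇑f) U) :
    IsClosed {q : Plane × Plane | ∃ w, Br f U w q.1 q.2} := by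
  rw [isClosed_iff_ultrafilter]
  rintro ⟨x0, y0⟩ u hu hs
  obtain ⟨C, hC, hCx, hCy⟩ := exists_cpt_nhds x0 y0
  obtain ⟨K, hK, H⟩ := Br_bdd hU hHP C hC
  have hx : Tendsto Prod.fst (u : Filter (Plane × Plane)) (𝓝 x0) :=
    (continuous_fst.tendsto (x0, y0)).mono_left hu
  have hy : Tendsto Prod.snd (u : Filter (Plane × Plane)) (𝓝 y0) :=
    (continuous_snd.tendsto (x0, y0)).mono_left hu
  have hex : ∀ q : Plane × Plane, ∃ w, (∃ w, Br f U w q.1 q.2) → Br f U w q.1 q.2 := by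
    intro q
    by_cases hq : ∃ w, Br f U w q.1 q.2
    · obtain ⟨w, hw⟩ := hq; exact ⟨w, fun _ => hw⟩
    · exact ⟨0, fun h => absurd h hq⟩
  choose w hw using hex
  have hB : ∀ᶠ q in (u : Filter (Plane × Plane)), Br f U (w q) q.1 q.2 :=
    mem_of_superset hs fun q hq => hw q hq
  have hmem : ∀ᶠ q in (u : Filter (Plane × Plane)), w q ∈ K := by
    filter_upwards [hB, hx hCx, hy hCy] with i h1 h2 h3 using H _ _ h2 _ h3 h1
  obtain ⟨w0, _, hw0⟩ := hK.ultrafilter_le_nhds' (u.map w) hmem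
  exact ⟨w0, Br_lim hU (l := (u : Filter (Plane × Plane))) hw0 hx hy hB⟩

open scoped unitInterval

def PS (f : Plane ≃ₜ Plane) (U : Plane → Plane → ℝ) (x y : Plane) : Prop :=
  ∃ γ : Path x y, ∀ t, St f U x (γ t)

lemma PS.refl (hU : IsLyapunovMetric (⇑f) U) (x : Plane) : PS f U x x :=
  ⟨Path.refl x, fun _ => St.refl hU x⟩

lemma PS.st {x y : Plane} (h : PS f U x y) : St f U x y := by
  obtain ⟨γ, hγ⟩ := h
  simpa using hγ 1

lemma PS.symm (hU : IsLyapunovMetric (⇑f) U) {x y : Plane} (h : PS f U x y) : PS f U y x := by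
  have h1 := h.st
  obtain ⟨γ, hγ⟩ := h
  exact ⟨γ.symm, fun t => (h1.symm hU).trans hU (hγ _)⟩

lemma PS.trans (hU : IsLyapunovMetric (⇑f) U) {x y z : Plane} (h : PS f U x y)
    (h' : PS f U y z) : PS f U x z := by
  have h1 := h.st
  obtain ⟨γ, hγ⟩ := h
  obtain ⟨δ, hδ⟩ := h'
  refine ⟨γ.trans δ, fun t => ?_⟩
  have : (γ.trans δ) t ∈ range (γ.trans δ) := ⟨t, rfl⟩
  rw [Path.trans_range] at this
  rcases this with ⟨s, hs⟩ | ⟨s, hs⟩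
  · rw [← hs]; exact hγ s
  · rw [← hs]; exact h1.trans hU (hδ s)

/-- chart -/
def Chart (f : Plane ≃ₜ Plane) (U : Plane → Plane → ℝ) (x : Plane) (h : ℝ × ℝ → Plane) : Prop :=
    ContinuousOn h (Icc (-1 : ℝ) 1 ×ˢ Icc (-1 : ℝ) 1) ∧
    InjOn h (Icc (-1 : ℝ) 1 ×ˢ Icc (-1 : ℝ) 1) ∧
    h (0, 0) = x ∧
    h '' (Icc (-1 : ℝ) 1 ×ˢ Icc (-1 : ℝ) 1) ∈ nhds x ∧
    (∀ s ∈ Icc (-1 : ℝ) 1, ∀ t ∈ Icc (-1 : ℝ) 1, St f U (h (0, s)) (h (t, s))) ∧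
    (∀ t ∈ Icc (-1 : ℝ) 1, ∀ s ∈ Icc (-1 : ℝ) 1, St f.symm U (h (t, 0)) (h (t, s)))

lemma exists_chart (hns : NoSingularities f U) (x : Plane) : ∃ h, Chart f U x h := by
  obtain ⟨k, _, h, h1, h2, h3, h4, h5, h6⟩ := hns x
  exact ⟨h, h1, h2, h3, h4, fun s hs t ht => ⟨k, h5 s hs t ht⟩, fun t ht s hs => ⟨k, h6 t ht s hs⟩⟩

lemma zero_mem : (0 : ℝ) ∈ Icc (-1 : ℝ) 1 := by norm_num

lemma Chart.swap {x : Plane} {h : ℝ × ℝ → Plane} (H : Chart f U x h) :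
    Chart f.symm U x (h ∘ Prod.swap) := by
  obtain ⟨h1, h2, h3, h4, h5, h6⟩ := H
  refine ⟨?_, ?_, h3, ?_, fun s hs t ht => h6 s hs t ht, fun s hs t ht => h5 s hs t ht⟩
  · exact h1.comp continuous_swap.continuousOn fun q hq => ⟨hq.2, hq.1⟩
  · exact h2.comp Prod.swap_injective.injOn fun q hq => ⟨hq.2, hq.1⟩
  · rw [image_comp, image_swap_prod]; exact h4

lemma local_prod (hU : IsLyapunovMetric (⇑f) U) (hns : NoSingularities f U) (x : Plane) :
    ∃ N ∈ 𝓝 x, ∀ a ∈ N, ∀ b ∈ N, ∃ w, Br f U w a b := by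
  obtain ⟨h, H⟩ := exists_chart hns x
  refine ⟨_, H.2.2.2.1, ?_⟩
  rintro _ ⟨⟨t, s⟩, ⟨ht, hs⟩, rfl⟩ _ ⟨⟨t', s'⟩, ⟨ht', hs'⟩, rfl⟩
  obtain ⟨h1, h2, h3, h4, h5, h6⟩ := H
  simp only at ht hs ht' hs'
  exact ⟨h (t, s'), ((h6 t ht s' hs').symm (symm_lyap hU)).trans (symm_lyap hU) (h6 t ht s hs),
    ((h5 s' hs' t ht).symm hU).trans hU (h5 s' hs' t' ht')⟩

lemma Chart.hpath {x : Plane} {h : ℝ × ℝ → Plane} (H : Chart f U x h) {t s : ℝ}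
    (ht : t ∈ Icc (-1 : ℝ) 1) (hs : s ∈ Icc (-1 : ℝ) 1) : PS f U (h (0, s)) (h (t, s)) := by
  have hm : ∀ r : I, (r : ℝ) * t ∈ Icc (-1 : ℝ) 1 := by
    intro r
    have := r.2.1; have := r.2.2
    constructor <;> nlinarith [ht.1, ht.2]
  refine ⟨⟨⟨fun r => h ((r : ℝ) * t, s), ?_⟩, by simp, by simp⟩, ?_⟩
  · exact H.1.comp_continuous (by fun_prop) fun r => ⟨hm r, hs⟩
  · intro r
    exact H.2.2.2.2.1 s hs _ (hm r)

lemma Chart.chain {x : Plane} {h : ℝ × ℝ → Plane} (H : Chart f U x h) {t s : ℝ}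
    (ht : t ∈ Icc (-1 : ℝ) 1) (hs : s ∈ Icc (-1 : ℝ) 1) :
    PS f U x (h (t, 0)) ∧ PS f.symm U (h (t, 0)) (h (t, s)) := by
  constructor
  · have := H.hpath ht zero_mem
    rwa [H.2.2.1] at this
  · have := H.swap.hpath hs ht
    simpa using this

lemma rect (hU : IsLyapunovMetric (⇑f) U) (hHP : PropertyHP (⇑f) U) (hns : NoSingularities f U)
    {a b c : Plane} (α : Path c a) (β : Path c b) (hα : ∀ t, St f U c (α t))
    (hβ : ∀ t, St f.symm U c (β t)) : ∀ s t, ∃ w, Br f U w (α t) (β s) := by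
  have hU' := symm_lyap hU
  have hDc := Br_closed hU hHP
  suffices hT : {s : I | ∀ t, ∃ w, Br f U w (α t) (β s)} = univ by
    intro s t
    exact (hT ▸ mem_univ s : s ∈ {s : I | ∀ t, ∃ w, Br f U w (α t) (β s)}) t
  have hcl : IsClosed {s : I | ∀ t, ∃ w, Br f U w (α t) (β s)} := by
    simp only [ofPred_forall]
    refine isClosed_iInter fun t => ?_
    exact hDc.preimage (f := fun s : I => (α t, β s)) (by fun_prop)
  have hop : IsOpen {s : I | ∀ t, ∃ w, Br f U w (α t) (β s)} := by
    rw [isOpen_iff_mem_nhds]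
    intro s0 hs0
    choose w hw using (show ∀ t, ∃ w, Br f U w (α t) (β s0) from hs0)
    have hwc : Continuous w := by
      rw [continuous_iff_continuousAt]
      intro t0
      exact Br_tendsto hU hHP (α.continuous.tendsto t0) tendsto_const_nhds
        (Eventually.of_forall hw) (hw t0)
    -- local step
    have loc : ∀ t0 : I, ∃ O : Set I, IsOpen O ∧ t0 ∈ O ∧ ∀ t1 ∈ O,
        (∀ᶠ s in 𝓝 s0, ∃ z, Br f U z (α t1) (β s)) →
        ∀ᶠ s in 𝓝 s0, ∀ t ∈ O, ∃ z, Br f U z (α t) (β s) := by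
      intro t0
      obtain ⟨N, hN, hNB⟩ := local_prod hU hns (w t0)
      obtain ⟨N', hN'N, hN'o, hN'w⟩ := mem_nhds_iff.1 hN
      refine ⟨w ⁻¹' N', hN'o.preimage hwc, hN'w, ?_⟩
      intro t1 ht1 hev
      have hex : ∀ s, ∃ z, (∃ z, Br f U z (α t1) (β s)) → Br f U z (α t1) (β s) := by
        intro s
        by_cases hq : ∃ z, Br f U z (α t1) (β s)
        · obtain ⟨z, hz⟩ := hq; exact ⟨z, fun _ => hz⟩
        · exact ⟨0, fun h => absurd h hq⟩
      choose v hv using hex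
      have hv' : ∀ᶠ s in 𝓝 s0, Br f U (v s) (α t1) (β s) := hev.mono fun s hs => hv s hs
      have hvt : Tendsto v (𝓝 s0) (𝓝 (w t1)) :=
        Br_tendsto hU hHP tendsto_const_nhds (β.continuous.tendsto s0) hv' (hw t1)
      filter_upwards [hv', hvt (hN'o.mem_nhds ht1)] with s h1 h2
      intro t ht
      obtain ⟨z, hz1, hz2⟩ := hNB _ (hN'N ht) _ (hN'N h2)
      exact ⟨z, hz1.trans hU' (hw t).1, hz2.trans hU h1.2⟩
    have hall : {t : I | ∀ᶠ s in 𝓝 s0, ∃ z, Br f U z (α t) (β s)} = univ := by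
      apply IsClopen.eq_univ
      · constructor
        · rw [← isOpen_compl_iff, isOpen_iff_mem_nhds]
          intro t0 ht0
          obtain ⟨O, hO, hO0, hOs⟩ := loc t0
          filter_upwards [hO.mem_nhds hO0] with t1 ht1 hc
          exact ht0 ((hOs t1 ht1 hc).mono fun s hs => hs t0 hO0)
        · rw [isOpen_iff_mem_nhds]
          intro t0 ht0
          obtain ⟨O, hO, hO0, hOs⟩ := loc t0
          filter_upwards [hO.mem_nhds hO0] with t1 ht1
          exact (hOs t0 hO0 ht0).mono fun s hs => hs t1 ht1
      · refine ⟨0, Eventually.of_forall fun s => ⟨β s, St.refl hU' _ |>.trans hU' ?_, St.refl hU _⟩⟩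
        simpa using (hβ s).symm hU'
    have hfin : ∀ᶠ s in 𝓝 s0, ∀ t ∈ (univ : Set I), ∃ z, Br f U z (α t) (β s) := by
      refine isCompact_univ.induction_on (p := fun A : Set I =>
        ∀ᶠ s in 𝓝 s0, ∀ t ∈ A, ∃ z, Br f U z (α t) (β s)) ?_ ?_ ?_ ?_
      · simp
      · intro A B hAB h
        exact h.mono fun s hs t ht => hs t (hAB ht)
      · intro A B h h'
        filter_upwards [h, h'] with s h1 h2 t ht
        exact ht.elim (h1 t) (h2 t)
      · intro t0 _
        obtain ⟨O, hO, hO0, hOs⟩ := loc t0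
        refine ⟨O, mem_nhdsWithin_of_mem_nhds (hO.mem_nhds hO0), hOs t0 hO0 ?_⟩
        exact (hall ▸ mem_univ t0 : t0 ∈ {t : I | ∀ᶠ s in 𝓝 s0, ∃ z, Br f U z (α t) (β s)})
    exact hfin.mono fun s hs t => hs t (mem_univ t)
  refine IsClopen.eq_univ ⟨hcl, hop⟩ ⟨0, fun t => ⟨α t, St.refl hU' _, ?_⟩⟩
  simpa using (hα t).symm hU

lemma commute (hU : IsLyapunovMetric (⇑f) U) (hHP : PropertyHP (⇑f) U)
    (hns : NoSingularities f U) {a b c : Plane} (h1 : PS f U c a) (h2 : PS f.symm U c b) :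
    ∃ w, PS f.symm U a w ∧ PS f U b w := by
  have hU' := symm_lyap hU
  obtain ⟨α, hα⟩ := h1
  obtain ⟨β, hβ⟩ := h2
  choose w hw using rect hU hHP hns α β hα hβ
  have hwa : w 0 1 = a := by
    refine (hw 0 1).uniq hU ⟨?_, ?_⟩
    · simpa using St.refl hU' _
    · simpa using (hα 1).symm hU
  have hwb : w 1 0 = b := by
    refine (hw 1 0).uniq hU ⟨?_, ?_⟩
    · simpa using (hβ 1).symm hU'
    · simpa using St.refl hU _
  have c1 : Continuous fun s => w s 1 := by
    rw [continuous_iff_continuousAt]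
    intro s0
    exact Br_tendsto hU hHP tendsto_const_nhds (β.continuous.tendsto s0)
      (Eventually.of_forall fun s => hw s 1) (hw s0 1)
  have c2 : Continuous fun t => w 1 t := by
    rw [continuous_iff_continuousAt]
    intro t0
    exact Br_tendsto hU hHP (α.continuous.tendsto t0) tendsto_const_nhds
      (Eventually.of_forall fun t => hw 1 t) (hw 1 t0)
  refine ⟨w 1 1, ⟨⟨⟨fun s => w s 1, c1⟩, hwa, rfl⟩, ?_⟩, ⟨⟨⟨fun t => w 1 t, c2⟩, hwb, rfl⟩, ?_⟩⟩
  · intro s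
    simpa using (hw s 1).1.symm hU'
  · intro t
    simpa using (hw 1 t).2.symm hU

lemma global (hU : IsLyapunovMetric (⇑f) U) (hHP : PropertyHP (⇑f) U)
    (hns : NoSingularities f U) (x y : Plane) : ∃ w, PS f.symm U x w ∧ PS f U w y := by
  have hU' := symm_lyap hU
  let R : Plane → Plane → Prop := fun x y => ∃ w, PS f.symm U x w ∧ PS f U w y
  have Rs : ∀ {x y}, R x y → R y x := by
    rintro x y ⟨w, h1, h2⟩
    obtain ⟨z, hz1, hz2⟩ := commute hU hHP hns h2 (h1.symm hU')
    exact ⟨z, hz1, hz2.symm hU⟩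
  have Rt : ∀ {x y z}, R x y → R y z → R x z := by
    rintro x y z ⟨w, h1, h2⟩ ⟨v, h3, h4⟩
    obtain ⟨q, hq1, hq2⟩ := commute hU hHP hns (h2.symm hU) h3
    exact ⟨q, h1.trans hU' hq1, (hq2.symm hU).trans hU h4⟩
  have Rn : ∀ x, ∀ᶠ y in 𝓝 x, R x y := by
    intro x
    obtain ⟨h, H⟩ := exists_chart hns x
    refine mem_of_superset H.2.2.2.1 ?_
    rintro _ ⟨⟨t, s⟩, ⟨ht, hs⟩, rfl⟩
    obtain ⟨h1, h2⟩ := H.chain ht hs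
    exact Rs ⟨_, h2.symm hU', h1.symm hU⟩
  have : {y | R x y} = univ := by
    apply IsClopen.eq_univ
    · constructor
      · rw [← isOpen_compl_iff, isOpen_iff_mem_nhds]
        intro y hy
        filter_upwards [Rn y] with z hz hc
        exact hy (Rt hc (Rs hz))
      · rw [isOpen_iff_mem_nhds]
        intro y hy
        filter_upwards [Rn y] with z hz
        exact Rt hy hz
    · exact ⟨x, x, PS.refl hU' x, PS.refl hU x⟩
  exact (this ▸ mem_univ y : y ∈ {y | R x y})

lemma St.ps (hU : IsLyapunovMetric (⇑f) U) (hHP : PropertyHP (⇑f) U)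
    (hns : NoSingularities f U) {x y : Plane} (h : St f U x y) : PS f U x y := by
  obtain ⟨w, h1, h2⟩ := global hU hHP hns x y
  have : x = w := CLH.uniq hU (h.trans hU (h2.st.symm hU)) h1.st
  exact this ▸ h2

lemma Un.ps (hU : IsLyapunovMetric (⇑f) U) (hHP : PropertyHP (⇑f) U)
    (hns : NoSingularities f U) {x y : Plane} (h : St f.symm U x y) : PS f.symm U x y := by
  obtain ⟨w, h1, h2⟩ := global hU hHP hns x y
  have : w = y := CLH.uniq hU h2.st ((h1.st.symm (symm_lyap hU)).trans (symm_lyap hU) h)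
  exact this ▸ h1

lemma growth (u : ℕ → ℝ) (N : ℕ) (h0 : 0 < u N) (h : ∀ n ≥ N, 2 * u n ≤ u (n+1)) (C : ℝ) :
    ∃ M ≥ N, ∀ n ≥ M, C < u n := by
  have key : ∀ m : ℕ, 2 ^ m * u N ≤ u (N + m) := by
    intro m
    induction m with
    | zero => simp
    | succ m ih =>
      have := h (N + m) (by omega)
      rw [← add_assoc, pow_succ]
      linarith
  obtain ⟨m0, hm0⟩ := pow_unbounded_of_one_lt (C / u N) (one_lt_two : (1 : ℝ) < 2)
  refine ⟨N + m0, by omega, fun n hn => ?_⟩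
  obtain ⟨m, rfl⟩ : ∃ m, n = N + m := ⟨n - N, by omega⟩
  have h1 : (2 : ℝ) ^ m0 ≤ 2 ^ m := pow_le_pow_right₀ one_le_two (by omega)
  rw [div_lt_iff₀ h0] at hm0
  nlinarith [key m]

lemma exists_semiconj (Gh : ℝ ≃ₜ ℝ) (l K : ℝ) (hl : |l| = 1/2) (hK : ∀ y, |l * y - Gh y| ≤ K) :
    ∃ φ : ℝ → ℝ, Continuous φ ∧ (∀ x, |φ x - x| ≤ 2 * K) ∧ ∀ x, φ (Gh x) = l * φ x := by
  let d : ℝ → ℝ := fun x => l * Gh.symm x - x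
  have hd : ∀ x, |d x| ≤ K := fun x => by simpa [d] using hK (Gh.symm x)
  have hdc : Continuous d := by fun_prop
  let T : ℕ → ℝ → ℝ := fun m x => l ^ m * d (Gh.symm^[m] x)
  have hT : ∀ m x, ‖T m x‖ ≤ K * (1/2) ^ m := by
    intro m x
    simp only [T, Real.norm_eq_abs, abs_mul, abs_pow, hl]
    rw [mul_comm]
    exact mul_le_mul_of_nonneg_right (hd _) (by positivity)
  have hs : HasSum (fun m : ℕ => K * (1/2 : ℝ) ^ m) (K * 2) := hasSum_geometric_two.mul_left K
  have hsum : ∀ x, Summable fun m => T m x := fun x =>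
    Summable.of_norm_bounded hs.summable (fun m => hT m x)
  refine ⟨fun x => x + ∑' m, T m x, ?_, ?_, ?_⟩
  · refine continuous_id.add (continuous_tsum (fun m => ?_) hs.summable hT)
    exact continuous_const.mul (hdc.comp (Gh.symm.continuous.iterate m))
  · intro x
    have := tsum_of_norm_bounded hs (fun m => hT m x)
    simp only [add_sub_cancel_left]
    rw [Real.norm_eq_abs] at this
    linarith
  · intro x
    simp only
    rw [(hsum (Gh x)).tsum_eq_zero_add]
    have : ∀ m, T (m+1) (Gh x) = l * T m x := by
      intro m
      simp only [T, Function.iterate_succ_apply, Homeomorph.symm_apply_apply, pow_succ]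
      ring
    simp only [this, tsum_mul_left]
    simp only [T, d, pow_zero, Function.iterate_zero, id, Homeomorph.symm_apply_apply]
    ring

lemma homeo_of_bdd (φ : ℝ → ℝ) (K : ℝ) (hc : Continuous φ) (hi : Function.Injective φ)
    (hb : ∀ x, |φ x - x| ≤ K) : ∃ e : ℝ ≃ₜ ℝ, ∀ x, e x = φ x := by
  have hsm : StrictMono φ := by
    rcases hc.strictMono_of_inj hi with h | h
    · exact h
    · exfalso
      have h1 := abs_le.1 (hb (|φ 0| + K + 1))
      have h2 := abs_le.1 (hb 0)
      have h3 : φ (|φ 0| + K + 1) < φ 0 := by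
        apply h
        have := abs_nonneg (φ 0)
        linarith
      linarith [le_abs_self (φ 0)]
  have hsur : Function.Surjective φ := by
    apply hc.surjective
    · refine tendsto_atTop_mono (f := fun x => x + (-K)) (fun x => ?_)
        (tendsto_atTop_add_const_right _ _ tendsto_id)
      linarith [abs_le.1 (hb x)]
    · refine tendsto_atBot_mono (f := fun x => x + K) (fun x => ?_)
        (tendsto_atBot_add_const_right _ _ tendsto_id)
      linarith [abs_le.1 (hb x)]
  exact ⟨(hsm.orderIsoOfSurjective φ hsur).toHomeomorph, fun x => rfl⟩

lemma linearize_aux (a b : ℝ) (ha : a < 0) (hb : 0 < b) (G : ℝ → ℝ)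
    (hc : ContinuousOn G (Icc a b)) (ε : ℝ) (hε : ε = 1 ∨ ε = -1)
    (hi : StrictMonoOn (fun x => ε * G x) (Icc a b))
    (hm : ∀ x ∈ Icc a b, G x ∈ Icc a b)
    (H : ∀ y : ℕ → ℝ, (∀ n, y n ∈ Icc a b) → (∀ n, G (y (n+1)) = y n) → y 0 = 0) :
    ∃ φ : ℝ ≃ₜ ℝ, ∀ x ∈ Icc a b, φ (G x) = (ε / 2) * φ x := by
  have hab : a ≤ b := by linarith
  have hε2 : ε * ε = 1 := by rcases hε with h | h <;> rw [h] <;> norm_num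
  have hε0 : ε ≠ 0 := by rcases hε with h | h <;> rw [h] <;> norm_num
  have hεa : |ε| = 1 := by rcases hε with h | h <;> rw [h] <;> norm_num
  let P : ℝ → ℝ := fun x => max a (min x b)
  have hP : ∀ x, P x ∈ Icc a b := fun x => ⟨le_max_left _ _, max_le hab (min_le_right _ _)⟩
  have hPc : Continuous P := by fun_prop
  have hPid : ∀ x ∈ Icc a b, P x = x := by
    intro x hx
    simp only [P]
    rw [min_eq_left hx.2, max_eq_right hx.1]
  have hPm : Monotone P := fun x y h => max_le_max le_rfl (min_le_min h le_rfl)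
  have hPm' : ∀ x y, x ≤ y → x - P x ≤ y - P y := by
    intro x y h
    simp only [P, max_def, min_def]
    split_ifs <;> linarith
  have hGP : Continuous fun x => G (P x) := hc.comp_continuous hPc hP
  let F : ℝ → ℝ := fun x => ε * G (P x) + (1/2) * (x - P x)
  have hFc : Continuous F :=
    (continuous_const.mul hGP).add (continuous_const.mul (continuous_id.sub hPc))
  have hFm : StrictMono F := by
    intro x y hxy
    simp only [F]
    rcases (hPm hxy.le).lt_or_eq with h | h
    · have := hi (hP x) (hP y) h
      simp only at this
      linarith [hPm' x y hxy.le]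
    · rw [h]; linarith
  have hFb : ∀ x, |F x - (1/2) * x| ≤ (|a| + |b|) * 2 := by
    intro x
    have h1 := hP x
    have h2 := hm _ h1
    have e1 : |P x| ≤ |a| + |b| := by
      rw [abs_of_neg ha, abs_of_pos hb, abs_le]; constructor <;> linarith [h1.1, h1.2]
    have e2 : |G (P x)| ≤ |a| + |b| := by
      rw [abs_of_neg ha, abs_of_pos hb, abs_le]; constructor <;> linarith [h2.1, h2.2]
    have e3 : F x - (1/2) * x = ε * G (P x) + (-(1/2)) * P x := by simp only [F]; ring
    rw [e3]
    refine (abs_add_le _ _).trans ?_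
    rw [abs_mul, abs_mul, hεa]
    have : |(-(1/2) : ℝ)| = 1/2 := by norm_num
    rw [this]
    linarith [abs_nonneg (P x)]
  have hFs : Function.Surjective F := by
    apply hFc.surjective
    · refine tendsto_atTop_mono (f := fun x => (1/2) * x + (-((|a| + |b|) * 2))) (fun x => ?_)
        (tendsto_atTop_add_const_right _ _ (tendsto_id.const_mul_atTop (one_half_pos (α := ℝ))))
      linarith [abs_le.1 (hFb x)]
    · refine tendsto_atBot_mono (f := fun x => (1/2) * x + ((|a| + |b|) * 2)) (fun x => ?_)
        (tendsto_atBot_add_const_right _ _ (tendsto_id.const_mul_atBot (one_half_pos (α := ℝ))))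
      linarith [abs_le.1 (hFb x)]
  let Gh : ℝ ≃ₜ ℝ := (hFm.orderIsoOfSurjective F hFs).toHomeomorph.trans (Homeomorph.mulLeft₀ ε hε0)
  have hGh : ∀ x, Gh x = G (P x) + ε / 2 * (x - P x) := by
    intro x
    change ε * F x = _
    simp only [F]
    linear_combination (G (P x)) * hε2
  have hGI : ∀ x ∈ Icc a b, Gh x = G x := by
    intro x hx
    rw [hGh, hPid x hx]; ring
  have hl : |ε / 2| = 1 / 2 := by rw [abs_div, hεa]; norm_num
  have hK : ∀ y, |ε / 2 * y - Gh y| ≤ (|a| + |b|) * 2 := by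
    intro y
    have : ε / 2 * y - Gh y = (-ε) * (F y - 1/2 * y) := by
      change ε / 2 * y - ε * F y = _
      ring
    rw [this, abs_mul, abs_neg, hεa, one_mul]
    exact hFb y
  obtain ⟨φ, hφc, hφb, hφe⟩ := exists_semiconj Gh (ε / 2) _ hl hK
  set K := 2 * ((|a| + |b|) * 2) with hKdef
  let E : ℕ → ℝ → ℝ := fun n => Gh.symm^[n]
  have hE : ∀ n x, Gh (E (n+1) x) = E n x := by
    intro n x
    simp only [E, Function.iterate_succ_apply', Homeomorph.apply_symm_apply]
  have hEinj : ∀ n, Function.Injective (E n) := fun n => Gh.symm.injective.iterate n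
  let d : ℝ → ℝ := fun z => |z - P z|
  have hd2 : ∀ z, 2 * d (Gh z) ≤ d z := by
    intro z
    have h1 := hm _ (hP z)
    have h2 : d (Gh z) ≤ |Gh z - G (P z)| := by
      simp only [d]
      generalize Gh z = q
      generalize G (P z) = r at h1
      obtain ⟨h3, h4⟩ := h1
      simp only [P, max_def, min_def]
      split_ifs <;> first
        | simp
        | (apply abs_le_abs <;> linarith)
        | (rw [abs_sub_comm q, abs_sub_comm q]; apply abs_le_abs <;> linarith)
    have h3 : |Gh z - G (P z)| = 1/2 * d z := by
      rw [hGh, add_sub_cancel_left, abs_mul, hl]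
    linarith
  have hout : ∀ z z', P z ≠ P z' → z ∉ Icc a b → d z ≤ |z - z'| := by
    intro z z' h hz
    have hz' : z < a ∨ b < z := by
      by_contra hcon
      push Not at hcon
      exact hz hcon
    simp only [d]
    rcases hz' with hz' | hz'
    · have e1 : P z = a := by simp only [P]; rw [min_eq_left (by linarith), max_eq_left hz'.le]
      have e2 : a < z' := by
        by_contra hcon
        push Not at hcon
        apply h
        rw [e1]; simp only [P]; rw [min_eq_left (by linarith), max_eq_left hcon]
      rw [e1, abs_sub_comm z, abs_sub_comm z]; apply abs_le_abs <;> linarith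
    · have e1 : P z = b := by simp only [P]; rw [min_eq_right (by linarith), max_eq_right hab]
      have e2 : z' < b := by
        by_contra hcon
        push Not at hcon
        apply h
        rw [e1]; simp only [P]; rw [min_eq_right (by linarith), max_eq_right hab]
      rw [e1]; apply abs_le_abs <;> linarith
  have main : ∀ x y, φ x = φ y → x ≠ 0 → x = y := by
    intro x y hxy hx0
    by_contra hne
    have hbd : ∀ n, |E n x - E n y| ≤ 2 * K := by
      intro n
      have h1 : φ (E n x) = φ (E n y) := by
        induction n with
        | zero => simpa [E] using hxy
        | succ n ih =>
          rw [← hE n x, ← hE n y, hφe, hφe] at ih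
          exact mul_left_cancel₀ (by simpa using hε0) ih
      have h2 := abs_le.1 (hφb (E n x))
      have h3 := abs_le.1 (hφb (E n y))
      rw [abs_le]; constructor <;> linarith
    obtain ⟨N, hN⟩ : ∃ N, E N x ∉ Icc a b := by
      by_contra hcon
      push Not at hcon
      apply hx0
      have := H (fun n => E n x) hcon (fun n => by rw [← hGI _ (hcon (n+1)), hE])
      simpa [E] using this
    have hNn : ∀ n ≥ N, E n x ∉ Icc a b := by
      intro n hn
      induction n, hn using Nat.le_induction with
      | base => exact hN
      | succ n hn ih =>
        intro hcon
        apply ih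
        rw [← hE, hGI _ hcon]
        exact hm _ hcon
    have hpos : 0 < d (E N x) := by
      simp only [d, abs_pos]
      intro hcon
      apply hN
      rw [sub_eq_zero] at hcon
      rw [hcon]; exact hP _
    obtain ⟨M, hMN, hM⟩ := growth (fun n => d (E n x)) N hpos
      (fun n _ => by have := hd2 (E (n+1) x); rwa [hE] at this) (2 * K)
    have hPP : ∀ n ≥ M, P (E n x) = P (E n y) := by
      intro n hn
      by_contra hcon
      have := hout _ _ hcon (hNn n (by omega))
      linarith [hM n hn, hbd n]
    obtain ⟨M', _, hM'⟩ := growth (fun n => |E n x - E n y|) M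
      (abs_pos.2 (sub_ne_zero.2 ((hEinj M).ne hne))) (fun n hn => by
        have h1 := hPP (n+1) (by omega)
        have h2 : E n x - E n y = ε / 2 * (E (n+1) x - E (n+1) y) := by
          rw [← hE n x, ← hE n y, hGh, hGh, h1]; ring
        rw [h2, abs_mul, hl]; linarith) (2 * K)
    linarith [hM' M' le_rfl, hbd M']
  have hinj : Function.Injective φ := by
    intro x y hxy
    by_cases hx : x = 0
    · by_cases hy : y = 0
      · rw [hx, hy]
      · exact (main y x hxy.symm hy).symm
    · exact main x y hxy hx
  obtain ⟨e, he⟩ := homeo_of_bdd φ _ hφc hinj hφb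
  exact ⟨e, fun x hx => by rw [he, he, ← hGI x hx, hφe]⟩

lemma linearize (a b : ℝ) (ha : a < 0) (hb : 0 < b) (G : ℝ → ℝ)
    (hc : ContinuousOn G (Icc a b)) (hi : InjOn G (Icc a b))
    (hm : ∀ x ∈ Icc a b, G x ∈ Icc a b)
    (H : ∀ y : ℕ → ℝ, (∀ n, y n ∈ Icc a b) → (∀ n, G (y (n+1)) = y n) → y 0 = 0) :
    ∃ l : ℝ, |l| = 1 / 2 ∧ ∃ φ : ℝ ≃ₜ ℝ, ∀ x ∈ Icc a b, φ (G x) = l * φ x := by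
  rcases hc.strictMonoOn_of_injOn_Icc' (by linarith) hi with h | h
  · exact ⟨1 / 2, by norm_num, linearize_aux a b ha hb G hc 1 (Or.inl rfl)
      (by simpa using h) hm H⟩
  · exact ⟨-1 / 2, by norm_num [abs_div], linearize_aux a b ha hb G hc (-1) (Or.inr rfl)
      (fun x hx y hy hxy => by have := h hx hy hxy; simp only; linarith) hm H⟩

lemma glue {S T : Type*} [TopologicalSpace S] [TopologicalSpace T] (g : S ≃ₜ S) (m : T ≃ₜ T)
    (A : Set S) (hA : IsOpen A) (hgA : ∀ x ∈ A, g x ∈ A) (hall : ∀ x, ∃ n : ℕ, g^[n] x ∈ A)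
    (e : S → T) (he : ContinuousOn e A) (hee : ∀ x ∈ A, e (g x) = m (e x)) :
    ∃ F : S → T, Continuous F ∧ (∀ x ∈ A, F x = e x) ∧ ∀ x, F (g x) = m (F x) := by
  choose n hn using hall
  have hstay : ∀ x k j, g^[k] x ∈ A → g^[k + j] x ∈ A ∧
      e (g^[k + j] x) = m^[j] (e (g^[k] x)) := by
    intro x k j h
    induction j with
    | zero => exact ⟨h, rfl⟩
    | succ j ih =>
      rw [← add_assoc, Function.iterate_succ_apply', Function.iterate_succ_apply']
      exact ⟨hgA _ ih.1, by rw [hee _ ih.1, ih.2]⟩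
  have hinv : ∀ j (t : T), m.symm^[j] (m^[j] t) = t := fun j =>
    Function.LeftInverse.iterate m.symm_apply_apply j
  have key : ∀ x k, g^[k] x ∈ A → m.symm^[n x] (e (g^[n x] x)) = m.symm^[k] (e (g^[k] x)) := by
    have aux : ∀ x k j, g^[k] x ∈ A →
        m.symm^[k + j] (e (g^[k + j] x)) = m.symm^[k] (e (g^[k] x)) := by
      intro x k j h
      rw [(hstay x k j h).2, Function.iterate_add_apply, hinv]
    intro x k hk
    rw [← aux x (n x) k (hn x), add_comm, aux x k (n x) hk]
  refine ⟨fun x => m.symm^[n x] (e (g^[n x] x)), ?_, ?_, ?_⟩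
  · rw [continuous_iff_continuousAt]
    intro x0
    have hgc : Continuous (g^[n x0]) := g.continuous.iterate _
    have hnb : ∀ᶠ x in 𝓝 x0, g^[n x0] x ∈ A := hgc.continuousAt (hA.mem_nhds (hn x0))
    have hca : ContinuousAt (fun x => m.symm^[n x0] (e (g^[n x0] x))) x0 := by
      refine (m.symm.continuous.iterate (n x0)).continuousAt.comp ?_
      exact (he.continuousAt (hA.mem_nhds (hn x0))).comp hgc.continuousAt
    refine hca.congr (hnb.mono fun x hx => (key x _ hx).symm)
  · intro x hx
    exact key x 0 hx
  · intro x
    have h1 : g^[n (g x) + 1] x ∈ A := by rw [Function.iterate_succ_apply]; exact hn (g x)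
    simp only
    rw [key x _ h1, Function.iterate_succ_apply', Homeomorph.apply_symm_apply]
    rfl

lemma glue_homeo {S T : Type*} [TopologicalSpace S] [TopologicalSpace T] (g : S ≃ₜ S) (m : T ≃ₜ T)
    (A : Set S) (hA : IsOpen A) (hgA : ∀ x ∈ A, g x ∈ A) (hall : ∀ x, ∃ n : ℕ, g^[n] x ∈ A)
    (B : Set T) (hB : IsOpen B) (hmB : ∀ x ∈ B, m x ∈ B) (hallB : ∀ x, ∃ n : ℕ, m^[n] x ∈ B)
    (e : S → T) (he : ContinuousOn e A) (hee : ∀ x ∈ A, e (g x) = m (e x))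
    (i : T → S) (hi : ContinuousOn i B) (heB : ∀ x ∈ A, e x ∈ B) (hiA : ∀ x ∈ B, i x ∈ A)
    (hie : ∀ x ∈ A, i (e x) = x) (hei : ∀ x ∈ B, e (i x) = x) :
    ∃ F : S ≃ₜ T, ∀ x, F (g x) = m (F x) := by
  obtain ⟨F, hF, hFA, hFe⟩ := glue g m A hA hgA hall e he hee
  obtain ⟨F', hF', hFA', hFe'⟩ := glue m g B hB hmB hallB i hi (by
    intro x hx
    have h1 := hee _ (hiA x hx)
    rw [hei x hx] at h1
    rw [← h1, hie _ (hgA _ (hiA x hx))])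
  have it : ∀ n x, F (g^[n] x) = m^[n] (F x) := fun n x => by
    induction n with
    | zero => rfl
    | succ n ih => rw [Function.iterate_succ_apply', Function.iterate_succ_apply', hFe, ih]
  have it' : ∀ n x, F' (m^[n] x) = g^[n] (F' x) := fun n x => by
    induction n with
    | zero => rfl
    | succ n ih => rw [Function.iterate_succ_apply', Function.iterate_succ_apply', hFe', ih]
  refine ⟨⟨⟨F, F', ?_, ?_⟩, hF, hF'⟩, hFe⟩
  · intro x
    obtain ⟨n, hn⟩ := hall x
    apply g.injective.iterate n
    rw [← it', ← it, hFA _ hn, hFA' _ (heB _ hn), hie _ hn]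
  · intro x
    obtain ⟨n, hn⟩ := hallB x
    apply m.injective.iterate n
    rw [← it, ← it', hFA' _ hn, hFA _ (hiA _ hn), hei _ hn]

lemma nhds_ball (hU : IsLyapunovMetric (⇑f) U) {p : Plane} {s : Set Plane} (hs : s ∈ 𝓝 p) :
    ∃ r > 0, ∀ y, U p y < r → y ∈ s := by
  obtain ⟨t, hts, hto, hpt⟩ := mem_nhds_iff.1 hs
  obtain ⟨r, hr, h⟩ := (hU.2.2.2 t).1 hto p hpt
  exact ⟨r, hr, fun y hy => hts (h y hy)⟩

lemma iter_fix {p : Plane} (hp : f p = p) (n : ℕ) : f^[n] p = p := Function.iterate_fixed hp n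

lemma attract_step (hU : IsLyapunovMetric (⇑f) U) {p : Plane} (hp : f p = p) {r : ℝ}
    {K : Set Plane} (hK : IsCompact K) (hrK : ∀ y, U p y < r → y ∈ K) {a : Plane}
    (ha : St f U p a) (hT : ∃ n : ℕ, U p (f^[n] a) < r) (ε : ℝ) (hε : 0 < ε) :
    ∃ n : ℕ, U p (f^[n] a) < ε := by
  obtain ⟨N, hN⟩ := hT
  have hanti : Antitone (fun n : ℕ => U p (f^[n] a)) := by
    have := ha.anti hU
    simpa only [iter_fix hp] using this
  have hlim := tendsto_atTop_ciInf hanti ⟨0, by rintro _ ⟨n, rfl⟩; exact hU.1.2.1 _ _⟩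
  set L := ⨅ n : ℕ, U p (f^[n] a) with hL
  obtain ⟨q, _, φ, hφ, hq⟩ := hK.tendsto_subseq (x := fun n => f^[n + N] a)
    (fun n => hrK _ ((hanti (Nat.le_add_left N n)).trans_lt hN))
  have hj : ∀ j : ℕ, U p (f^[j] q) = L := by
    intro j
    have h1 : Tendsto (fun n => U p (f^[j] (f^[φ n + N] a))) atTop (𝓝 (U p (f^[j] q))) := by
      have : Continuous fun z => U p (f^[j] z) :=
        U_cont hU continuous_const (f.continuous.iterate j)
      exact (this.tendsto q).comp hq
    have h2 : Tendsto (fun n => U p (f^[j] (f^[φ n + N] a))) atTop (𝓝 L) := by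
      have h3 : Tendsto (fun n => j + (φ n + N)) atTop atTop :=
        tendsto_atTop_mono (fun n => by have := hφ.le_apply (x := n); simp only [id]; omega) tendsto_id
      have := hlim.comp h3
      refine this.congr fun n => ?_
      simp only [Function.comp, Function.iterate_add_apply]
    exact tendsto_nhds_unique h1 h2
  have hqp : p = q := by
    by_contra hne
    have := hU.1.2.2.2 p q hne
    have h0 := hj 0
    have h1 := hj 1
    have h2 := hj 2
    simp only [Function.iterate_succ_apply, Function.iterate_zero, id] at h0 h1 h2
    simp only [Wd, Vd, hp, h0, h1, h2] at this
    linarith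
  have hL0 : L = 0 := by rw [← hj 0, ← hqp]; exact U_self hU p
  rw [hL0] at hlim
  exact (hlim.eventually (gt_mem_nhds hε)).exists

lemma attract (hU : IsLyapunovMetric (⇑f) U) {p : Plane} (hp : f p = p) {a : Plane}
    (ha : PS f U p a) (ε : ℝ) (hε : 0 < ε) : ∃ n : ℕ, U p (f^[n] a) < ε := by
  obtain ⟨K, hK, hKp⟩ := exists_compact_mem_nhds p
  obtain ⟨r, hr, hrK⟩ := nhds_ball hU hKp
  obtain ⟨γ, hγ⟩ := ha
  have hall : {t : I | ∃ n : ℕ, U p (f^[n] (γ t)) < r} = univ := by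
    apply IsClopen.eq_univ
    · constructor
      · rw [← isOpen_compl_iff, isOpen_iff_mem_nhds]
        intro t0 ht0
        have hc : Continuous fun t => U (γ t0) (γ t) := U_cont hU continuous_const γ.continuous
        have h1 : ∀ᶠ t in 𝓝 t0, U (γ t0) (γ t) < r / 2 := by
          refine hc.continuousAt.eventually_lt continuousAt_const ?_
          rw [U_self hU]; linarith
        filter_upwards [h1] with t ht hcon
        apply ht0
        obtain ⟨n, hn⟩ := attract_step hU hp hK hrK (hγ t) hcon (r / 2) (by linarith)
        refine ⟨n, ?_⟩
        have h2 := ((hγ t0).symm hU |>.trans hU (hγ t)).anti hU (Nat.zero_le n)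
        simp only [Function.iterate_zero, id] at h2
        have h3 := hU.2.2.1 p (f^[n] (γ t)) (f^[n] (γ t0))
        rw [hU.2.1 (f^[n] (γ t))] at h3
        linarith
      · simp only [ofPred_exists]
        refine isOpen_iUnion fun n => isOpen_lt ?_ continuous_const
        exact U_cont hU continuous_const ((f.continuous.iterate n).comp γ.continuous)
    · refine ⟨0, 0, ?_⟩
      simpa [U_self hU] using hr
  have h1 : (1 : I) ∈ {t : I | ∃ n : ℕ, U p (f^[n] (γ t)) < r} := hall ▸ mem_univ _
  simp only [mem_ofPred_eq, Path.target] at h1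
  refine attract_step hU hp hK hrK ?_ h1 ε hε
  simpa using hγ 1

lemma inv_cont {J : ℝ → Plane} (hJ : Continuous J) (hi : InjOn J (Icc (-1) 1)) :
    ∃ Ji : Plane → ℝ, ContinuousOn Ji (J '' Icc (-1) 1) ∧
      (∀ x ∈ Icc (-1 : ℝ) 1, Ji (J x) = x) := by
  have hl := hi.leftInvOn_invFunOn
  refine ⟨Function.invFunOn J (Icc (-1) 1), ?_, fun x hx => hl hx⟩
  rintro _ ⟨x0, hx0, rfl⟩
  have hmem : ∀ᶠ z in 𝓝[J '' Icc (-1) 1] (J x0), z ∈ J '' Icc (-1 : ℝ) 1 := self_mem_nhdsWithin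
  unfold ContinuousWithinAt
  rw [hl hx0]
  refine (isCompact_Icc (a := (-1 : ℝ)) (b := 1)).tendsto_nhds_of_unique_mapClusterPt ?_ ?_
  · filter_upwards [hmem] with z hz using Function.invFunOn_mem hz
  · intro y hy hcl
    obtain ⟨u, hu, hyu⟩ := mapClusterPt_iff_ultrafilter.1 hcl
    apply hi hy hx0
    have h1 : Tendsto (fun z => J (Function.invFunOn J (Icc (-1) 1) z)) (u : Filter Plane)
      (𝓝 (J y)) := (hJ.tendsto y).comp hyu
    have h2 : Tendsto (fun z => J (Function.invFunOn J (Icc (-1) 1) z)) (u : Filter Plane)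
        (𝓝 (J x0)) := by
      have h3 : Tendsto (fun z : Plane => z) (u : Filter Plane) (𝓝 (J x0)) :=
        le_trans hu nhdsWithin_le_nhds
      refine h3.congr' ?_
      filter_upwards [hu hmem] with z hz using (Function.invFunOn_eq hz).symm
    exact tendsto_nhds_unique h1 h2

lemma first_hit {u : ℝ → ℝ} (hu : Continuous u) {k : ℝ} (h0 : u 0 < k) (h1 : k < u 1) :
    ∃ b, 0 < b ∧ b < 1 ∧ u b = k ∧ ∀ y ∈ Icc 0 b, u y ≤ k := by
  let A : Set ℝ := Icc 0 1 ∩ {y | k ≤ u y}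
  have hA : IsCompact A := isCompact_Icc.inter_right (isClosed_le continuous_const hu)
  have hne : A.Nonempty := ⟨1, ⟨by norm_num, h1.le⟩⟩
  have hb := hA.sInf_mem hne
  set b := sInf A
  have hlt : ∀ y ∈ Icc 0 1, k ≤ u y → b ≤ y := fun y hy hk => csInf_le hA.bddBelow ⟨hy, hk⟩
  have hub : u b = k := by
    obtain ⟨c, hc, hck⟩ := intermediate_value_Icc hb.1.1 hu.continuousOn
      (show k ∈ Icc (u 0) (u b) from ⟨h0.le, hb.2⟩)
    have := hlt c ⟨hc.1, hc.2.trans hb.1.2⟩ hck.ge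
    rw [← hck, le_antisymm hc.2 this]
  refine ⟨b, ?_, ?_, hub, ?_⟩
  · rcases hb.1.1.lt_or_eq with h | h
    · exact h
    · rw [← h] at hub; linarith
  · rcases hb.1.2.lt_or_eq with h | h
    · exact h
    · rw [h] at hub; linarith
  · intro y hy
    by_contra hcon
    push Not at hcon
    have := hlt y ⟨hy.1, hy.2.trans hb.1.2⟩ hcon.le
    rw [le_antisymm this hy.2] at hub
    linarith [hub]

lemma St_fix_iff {p : Plane} (hp : f p = p) (z : Plane) : St f U p z ↔ St f U p (f z) := by
  constructor
  · intro h; have := h.map; rwa [hp] at this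
  · intro h; apply St.of_map; rwa [hp]

lemma line (hU : IsLyapunovMetric (⇑f) U) {p : Plane} (hp : f p = p)
    (hps : ∀ z, St f U p z → PS f U p z) {h : ℝ × ℝ → Plane} (H : Chart f U p h) :
    ∃ l : ℝ, |l| = 1 / 2 ∧ ∃ F : {z // St f U p z} ≃ₜ ℝ,
      ∀ z w : {z // St f U p z}, w.1 = f z.1 → F w = l * F z := by
  obtain ⟨hc, hinj, h00, hnb, hst, hun⟩ := H
  have clip : ∀ x : ℝ, max (-1) (min x 1) ∈ Icc (-1 : ℝ) 1 := fun x =>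
    ⟨le_max_left _ _, max_le (by norm_num) (min_le_right _ _)⟩
  obtain ⟨J, hJdef⟩ : ∃ J : ℝ → Plane, J = fun x => h (max (-1) (min x 1), 0) := ⟨_, rfl⟩
  have hJI : ∀ x ∈ Icc (-1 : ℝ) 1, J x = h (x, 0) := by
    intro x hx
    rw [hJdef]
    simp only
    rw [min_eq_left hx.2, max_eq_right hx.1]
  have hJc : Continuous J := by
    rw [hJdef]
    exact hc.comp_continuous (by fun_prop) fun x => ⟨clip x, zero_mem⟩
  have hJs : ∀ x, St f U p (J x) := by
    intro x
    have := hst 0 zero_mem _ (clip x)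
    rw [h00] at this
    rw [hJdef]; exact this
  have hJi : InjOn J (Icc (-1) 1) := by
    intro x hx y hy hxy
    rw [hJI x hx, hJI y hy] at hxy
    exact congrArg Prod.fst (hinj ⟨hx, zero_mem⟩ ⟨hy, zero_mem⟩ hxy)
  have hJ0 : J 0 = p := by rw [hJI 0 zero_mem, h00]
  obtain ⟨r, hr, hrh⟩ := nhds_ball hU hnb
  have hrJ : ∀ z, St f U p z → U p z < r → z ∈ J '' Icc (-1) 1 := by
    intro z hz hzr
    obtain ⟨⟨t, s⟩, ⟨ht, hs⟩, rfl⟩ := hrh z hzr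
    simp only at ht hs
    have h1 : St f U (h (0, 0)) (h (0, s)) := by
      rw [h00]; exact hz.trans hU ((hst s hs t ht).symm hU)
    have h2 := uniq hU h1 (hun 0 zero_mem s hs)
    have h3 := congrArg Prod.snd (hinj ⟨zero_mem, zero_mem⟩ ⟨zero_mem, hs⟩ h2)
    simp only at h3
    subst h3
    exact ⟨t, ht, hJI t ht⟩
  obtain ⟨Ji, hJic, hJil⟩ := inv_cont hJc hJi
  have hJir : ∀ z ∈ J '' Icc (-1) 1, J (Ji z) = z ∧ Ji z ∈ Icc (-1 : ℝ) 1 := by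
    rintro _ ⟨x, hx, rfl⟩
    rw [hJil x hx]; exact ⟨rfl, hx⟩
  have hUpos : ∀ z, z ≠ p → 0 < U p z := fun z hz =>
    lt_of_le_of_ne (hU.1.2.1 _ _) fun h => hz ((hU.1.2.2.1 p z).1 h.symm).symm
  have hJne : ∀ x ∈ Icc (-1 : ℝ) 1, x ≠ 0 → J x ≠ p := by
    intro x hx hx0 hcon
    exact hx0 (hJi hx zero_mem (hcon.trans hJ0.symm))
  obtain ⟨k, hk0, hkr, hk1, hk2⟩ : ∃ k, 0 < k ∧ k < r ∧ k < U p (J 1) ∧ k < U p (J (-1)) := by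
    have e1 := hUpos _ (hJne 1 (by norm_num) (by norm_num))
    have e2 := hUpos _ (hJne (-1) (by norm_num) (by norm_num))
    obtain ⟨k, hk0, hk⟩ := exists_between (lt_min hr (lt_min e1 e2))
    simp only [lt_min_iff] at hk
    exact ⟨k, hk0, hk.1, hk.2.1, hk.2.2⟩
  have huc : Continuous fun x => U p (J x) := U_cont hU continuous_const hJc
  have hu0 : U p (J 0) = 0 := by rw [hJ0]; exact U_self hU p
  obtain ⟨b, hb0, hb1, hbk, hbl⟩ := first_hit (u := fun x => U p (J x)) huc
    (by simp only [hu0]; exact hk0) hk1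
  obtain ⟨a', ha0, ha1, hak, hal⟩ := first_hit (u := fun x => U p (J (-x)))
    (huc.comp continuous_neg) (by simp only [neg_zero, hu0]; exact hk0) hk2
  obtain ⟨a, rfl⟩ : ∃ a, a' = -a := ⟨-a', by ring⟩
  simp only [neg_neg] at hak
  have hIl : ∀ x ∈ Icc a b, U p (J x) ≤ k := by
    intro x hx
    rcases le_total 0 x with h | h
    · exact hbl x ⟨h, hx.2⟩
    · have := hal (-x) ⟨by linarith, by linarith [hx.1]⟩
      simpa using this
  have hI1 : ∀ x ∈ Icc a b, x ∈ Icc (-1 : ℝ) 1 := fun x hx =>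
    ⟨by linarith [hx.1], by linarith [hx.2]⟩
  have hstep : ∀ z, St f U p z → U p (f z) ≤ U p z := by
    intro z hz
    have := hz.U_step hU
    rwa [hp] at this
  have hsteplt : ∀ z, St f U p z → z ≠ p → U p (f z) < U p z := by
    intro z hz hne
    have := hz.lt hU hne.symm
    unfold Vd at this
    rw [hp] at this
    linarith
  let G : ℝ → ℝ := fun x => Ji (f (J x))
  have hfJ : ∀ x ∈ Icc a b, f (J x) ∈ J '' Icc (-1) 1 := fun x hx =>
    hrJ _ ((St_fix_iff hp _).1 (hJs x)) (by linarith [hstep _ (hJs x), hIl x hx])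
  have hJG : ∀ x ∈ Icc a b, J (G x) = f (J x) := fun x hx => (hJir _ (hfJ x hx)).1
  have hG1 : ∀ x ∈ Icc a b, G x ∈ Icc (-1 : ℝ) 1 := fun x hx => (hJir _ (hfJ x hx)).2
  have hGc : ContinuousOn G (Icc a b) :=
    hJic.comp (f.continuous.comp hJc).continuousOn hfJ
  have hGinj : InjOn G (Icc a b) := by
    intro x hx y hy hxy
    have : f (J x) = f (J y) := by rw [← hJG x hx, ← hJG y hy, hxy]
    exact hJi (hI1 x hx) (hI1 y hy) (f.injective this)
  have h0I : (0 : ℝ) ∈ Icc a b := ⟨by linarith, hb0.le⟩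
  have hG0 : G 0 = 0 := by
    simp only [G]; rw [hJ0, hp, ← hJ0, hJil 0 zero_mem]
  have hno : ∀ x ∈ Icc a b, ∀ c, c ≠ 0 → U p (J c) = k → c ∉ uIcc (G 0) (G x) := by
    intro x hx c hc0 hck hcm
    have hsub : uIcc 0 x ⊆ Icc a b := ordConnected_Icc.uIcc_subset h0I hx
    obtain ⟨z, hz, hzc⟩ := intermediate_value_uIcc (hGc.mono hsub) hcm
    have hzI := hsub hz
    have hz0 : z ≠ 0 := by rintro rfl; exact hc0 (hzc ▸ hG0)
    have h1 := hsteplt _ (hJs z) (hJne z (hI1 z hzI) hz0)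
    rw [← hJG z hzI, hzc, hck] at h1
    linarith [hIl z hzI]
  have hGo : ∀ x ∈ Icc a b, G x ∈ Ioo a b := by
    intro x hx
    constructor
    · by_contra hcon
      push Not at hcon
      refine hno x hx a (by linarith) hak ?_
      rw [hG0, uIcc_of_ge (by linarith)]
      exact ⟨hcon, by linarith⟩
    · by_contra hcon
      push Not at hcon
      refine hno x hx b (by linarith) hbk ?_
      rw [hG0, uIcc_of_le (by linarith)]
      exact ⟨by linarith, hcon⟩
  obtain ⟨l, hl, φ, hφ⟩ := linearize a b (by linarith) hb0 G hGc hGinj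
    (fun x hx => Ioo_subset_Icc_self (hGo x hx)) (by
      intro y hy hyG
      have h1 : ∀ n, f.symm^[n] (J (y 0)) = J (y n) := by
        intro n
        induction n with
        | zero => rfl
        | succ n ih =>
          rw [Function.iterate_succ_apply', ih, ← hyG n, hJG _ (hy (n+1)),
            Homeomorph.symm_apply_apply]
      have hp' : f.symm p = p := by rw [Homeomorph.symm_apply_eq, hp]
      have h2 : St f.symm U p (J (y 0)) := ⟨k, fun n => by
        rw [h1, iter_fix hp']; exact hIl _ (hy n)⟩
      have h3 := uniq hU (hJs (y 0)) h2
      by_contra hcon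
      exact hJne _ (hI1 _ (hy 0)) hcon h3.symm)
  have hl0 : l ≠ 0 := by rintro rfl; norm_num at hl
  have hφ0 : φ 0 = 0 := by
    have h1 := hφ 0 h0I
    rw [hG0] at h1
    by_contra hcon
    have : l = 1 := by
      have h2 : (l - 1) * φ 0 = 0 := by linarith
      rcases mul_eq_zero.1 h2 with h | h
      · linarith
      · exact absurd h hcon
    rw [this] at hl; norm_num at hl
  refine ⟨l, hl, ?_⟩
  let g : {z // St f U p z} ≃ₜ {z // St f U p z} := f.subtype (St_fix_iff hp)
  have hg : ∀ z, (g z).1 = f z.1 := fun z => rfl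
  have hgn : ∀ (n : ℕ) z, (g^[n] z).1 = f^[n] z.1 := by
    intro n z
    induction n with
    | zero => rfl
    | succ n ih => rw [Function.iterate_succ_apply', Function.iterate_succ_apply', hg, ih]
  let A : Set {z // St f U p z} := {z | U p z.1 < r} ∩ (fun z => Ji z.1) ⁻¹' Ioo a b
  have hAJ : ∀ z : {z // St f U p z}, U p z.1 < r → z.1 ∈ J '' Icc (-1) 1 := fun z hz =>
    hrJ z.1 z.2 hz
  have hJiS : ContinuousOn (fun z : {z // St f U p z} => Ji z.1) {z | U p z.1 < r} :=
    hJic.comp continuous_subtype_val.continuousOn hAJ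
  have hA : IsOpen A := by
    refine hJiS.isOpen_inter_preimage ?_ isOpen_Ioo
    exact isOpen_lt (U_cont hU continuous_const continuous_subtype_val) continuous_const
  have hAe : ∀ z ∈ A, J (Ji z.1) = z.1 ∧ Ji z.1 ∈ Icc a b := fun z hz =>
    ⟨(hJir _ (hAJ z hz.1)).1, Ioo_subset_Icc_self hz.2⟩
  have hJA : ∀ x ∈ Ioo a b, (⟨J x, hJs x⟩ : {z // St f U p z}) ∈ A := by
    intro x hx
    have hx' := Ioo_subset_Icc_self hx
    refine ⟨(hIl x hx').trans_lt hkr, ?_⟩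
    simp only [mem_preimage]
    rw [hJil x (hI1 x hx')]; exact hx
  have hJig : ∀ z ∈ A, Ji (g z).1 = G (Ji z.1) := by
    intro z hz
    simp only [G, hg]; rw [(hAe z hz).1]
  have hgA : ∀ z ∈ A, g z ∈ A := by
    intro z hz
    refine ⟨(hstep _ z.2).trans_lt hz.1, ?_⟩
    simp only [mem_preimage]
    rw [hJig z hz]
    exact hGo _ (hAe z hz).2
  obtain ⟨F, hF⟩ := glue_homeo g (Homeomorph.mulLeft₀ l hl0) A hA hgA (by
      intro z
      have hpA : (⟨p, St.refl hU p⟩ : {z // St f U p z}) ∈ A := by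
        have := hJA 0 ⟨by linarith, hb0⟩
        simpa only [hJ0] using this
      obtain ⟨O, hO, hOA⟩ := isOpen_induced_iff.1 hA
      have hpO : p ∈ O := by rw [← hOA] at hpA; exact hpA
      obtain ⟨δ, hδ, hδO⟩ := nhds_ball hU (hO.mem_nhds hpO)
      obtain ⟨n, hn⟩ := attract hU hp (hps z.1 z.2) δ hδ
      refine ⟨n, ?_⟩
      rw [← hOA]
      change (g^[n] z).1 ∈ O
      rw [hgn]
      exact hδO _ hn)
    (φ '' Ioo a b) (φ.isOpenMap _ isOpen_Ioo) (by
      rintro _ ⟨x, hx, rfl⟩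
      have hx' := Ioo_subset_Icc_self hx
      exact ⟨G x, hGo x hx', hφ x hx'⟩)
    (by
      intro t
      have hn : ∀ n : ℕ, (Homeomorph.mulLeft₀ l hl0)^[n] t = l ^ n * t := by
        intro n
        induction n with
        | zero => simp
        | succ n ih =>
          rw [Function.iterate_succ_apply', ih, pow_succ]
          simp only [Homeomorph.coe_mulLeft₀]
          ring
      have ht : Tendsto (fun n : ℕ => l ^ n * t) atTop (𝓝 0) := by
        have := (tendsto_pow_atTop_nhds_zero_of_abs_lt_one (r := l) (by rw [hl]; norm_num)).mul_const t
        simpa using this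
      have hB : φ '' Ioo a b ∈ 𝓝 (0 : ℝ) :=
        (φ.isOpenMap _ isOpen_Ioo).mem_nhds ⟨0, ⟨by linarith, hb0⟩, hφ0⟩
      obtain ⟨n, hn'⟩ := (ht.eventually hB).exists
      exact ⟨n, by rw [hn]; exact hn'⟩)
    (fun z => φ (Ji z.1)) (φ.continuous.comp_continuousOn (hJiS.mono inter_subset_left))
    (by
      intro z hz
      simp only [Homeomorph.coe_mulLeft₀]
      rw [hJig z hz, hφ _ (hAe z hz).2])
    (fun t => ⟨J (φ.symm t), hJs _⟩)
    ((hJc.comp φ.symm.continuous).subtype_mk _).continuousOn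
    (fun z hz => ⟨_, hz.2, rfl⟩)
    (by
      rintro _ ⟨x, hx, rfl⟩
      simp only [Homeomorph.symm_apply_apply]
      exact hJA x hx)
    (by
      intro z hz
      apply Subtype.ext
      simp only [Homeomorph.symm_apply_apply]
      exact (hAe z hz).1)
    (by
      rintro _ ⟨x, hx, rfl⟩
      simp only [Homeomorph.symm_apply_apply]
      rw [hJil x (hI1 x (Ioo_subset_Icc_self hx))])
  refine ⟨F, fun z w hw => ?_⟩
  have : w = g z := Subtype.ext hw
  rw [this, hF]
  rfl

end CLH

/-- A homeomorphism of the plane with a fixed point and without singularities, admitting a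
Lyapunov metric function with the sign condition and property HP, is topologically
conjugate to a linear hyperbolic automorphism: an invertible linear map none of whose
complex eigenvalues (roots of the complexified characteristic polynomial) has modulus 1. -/
theorem conjugate_to_linear_hyperbolic (f : Plane ≃ₜ Plane) (U : Plane → Plane → ℝ)
    (hfix : ∃ x : Plane, f x = x)
    (hU : IsLyapunovMetric (⇑f) U) (hsign : SignCondition (⇑f) U)
    (hns : NoSingularities f U) (hHP : PropertyHP (⇑f) U) :
    ∃ h : Plane ≃ₜ Plane, ∃ A : Plane →ₗ[ℝ] Plane, Function.Bijective A ∧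
      (∀ μ : ℂ, (Polynomial.map (algebraMap ℝ ℂ) (LinearMap.charpoly A)).IsRoot μ →
        ‖μ‖ ≠ 1) ∧
      ∀ x : Plane, h (f x) = A (h x) := by
  obtain ⟨p, hp⟩ := hfix
  have hU' := CLH.symm_lyap hU
  have hp' : f.symm p = p := by rw [Homeomorph.symm_apply_eq, hp]
  obtain ⟨c, hc⟩ := CLH.exists_chart hns p
  obtain ⟨l, hl, F, hF⟩ := CLH.line hU hp (fun z hz => CLH.St.ps hU hHP hns hz) hc
  obtain ⟨m, hm, E, hE⟩ := CLH.line (f := f.symm) hU' hp'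
    (fun z hz => CLH.Un.ps hU hHP hns hz) hc.swap
  have hbr : ∀ x y, ∃ w, CLH.Br f U w x y := by
    intro x y
    obtain ⟨w, h1, h2⟩ := CLH.global hU hHP hns x y
    exact ⟨w, h1.st.symm hU', h2.st⟩
  choose B hB using hbr
  have hBc : Continuous fun q : Plane × Plane => B q.1 q.2 := by
    rw [continuous_iff_continuousAt]
    intro q
    exact CLH.Br_tendsto hU hHP continuous_fst.continuousAt continuous_snd.continuousAt
      (Filter.Eventually.of_forall fun q => hB q.1 q.2) (hB q.1 q.2)
  let Q : Plane ≃ₜ {z // CLH.St f U p z} × {z // CLH.St f.symm U p z} :=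
    { toFun := fun x => (⟨B x p, (hB x p).2.symm hU⟩, ⟨B p x, (hB p x).1.symm hU'⟩)
      invFun := fun q => B q.1.1 q.2.1
      left_inv := fun x => (hB _ _).uniq hU ⟨(hB x p).1.symm hU', (hB p x).2.symm hU⟩
      right_inv := by
        rintro ⟨⟨a, ha⟩, ⟨b, hb⟩⟩
        refine Prod.ext (Subtype.ext ?_) (Subtype.ext ?_)
        · exact (hB _ _).uniq hU ⟨(hB a b).1.symm hU', ha.symm hU⟩
        · exact (hB _ _).uniq hU ⟨hb.symm hU', (hB a b).2.symm hU⟩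
      continuous_toFun := by
        refine Continuous.prodMk ?_ ?_
        · exact (hBc.comp (continuous_id.prodMk continuous_const)).subtype_mk _
        · exact (hBc.comp (continuous_const.prodMk continuous_id)).subtype_mk _
      continuous_invFun := hBc.comp ((continuous_subtype_val.comp continuous_fst).prodMk
        (continuous_subtype_val.comp continuous_snd)) }
  have hl0 : l ≠ 0 := by rintro rfl; norm_num at hl
  have hm0 : m ≠ 0 := by rintro rfl; norm_num at hm
  have hQ1 : ∀ x, (Q (f x)).1.1 = f (Q x).1.1 := by
    intro x
    refine (hB (f x) p).uniq hU ⟨?_, ?_⟩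
    · have h1 : CLH.St f.symm U (f.symm (f (B x p))) (f.symm (f x)) := by simpa using (hB x p).1
      exact h1.of_map
    · have := (hB x p).2.map
      rwa [hp] at this
  have hQ2 : ∀ x, (Q x).2.1 = f.symm (Q (f x)).2.1 := by
    intro x
    refine (hB p x).uniq hU ⟨?_, ?_⟩
    · have := (hB p (f x)).1.map
      rwa [hp'] at this
    · have := (hB p (f x)).2.map_symm
      rwa [Homeomorph.symm_apply_apply] at this
  refine ⟨Q.trans (F.prodCongr E), LinearMap.prodMap (l • LinearMap.id) (m⁻¹ • LinearMap.id),
    ?_, ?_, ?_⟩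
  · constructor
    · rintro ⟨a, b⟩ ⟨a', b'⟩ h
      simpa [hl0, hm0] using h
    · rintro ⟨a, b⟩
      exact ⟨(l⁻¹ * a, m * b), by simp [hl0, hm0]⟩
  · intro μ hμ
    have key : LinearMap.charpoly (LinearMap.prodMap (l • (LinearMap.id : ℝ →ₗ[ℝ] ℝ))
        (m⁻¹ • (LinearMap.id : ℝ →ₗ[ℝ] ℝ))) =
        (Polynomial.X - Polynomial.C l) * (Polynomial.X - Polynomial.C m⁻¹) := by
      have h1 : ∀ r : ℝ, LinearMap.charpoly (r • (LinearMap.id : ℝ →ₗ[ℝ] ℝ)) =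
          Polynomial.X - Polynomial.C r := by
        intro r
        rw [← LinearMap.charpoly_toMatrix _ (Module.Basis.singleton Unit ℝ)]
        simp [Matrix.charpoly, Matrix.charmatrix, Module.Basis.toMatrix_apply]
      rw [LinearMap.charpoly_prodMap, h1, h1]
    rw [key] at hμ
    simp only [Polynomial.map_mul, Polynomial.map_sub, Polynomial.map_X, Polynomial.map_C,
      Polynomial.IsRoot.def, Polynomial.eval_mul, Polynomial.eval_sub, Polynomial.eval_X,
      Polynomial.eval_C, mul_eq_zero, sub_eq_zero] at hμ
    rcases hμ with h | h
    · rw [h, norm_algebraMap', Real.norm_eq_abs, hl]; norm_num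
    · rw [h, norm_algebraMap', Real.norm_eq_abs, abs_inv, hm]; norm_num
  · intro x
    have h1 := hF _ _ (hQ1 x)
    have h2 := hE _ _ (hQ2 x)
    refine Prod.ext ?_ ?_
    · simpa using h1
    · change E (Q (f x)).2 = m⁻¹ * E (Q x).2
      rw [h2, inv_mul_cancel_left₀ hm0]
end

section
/- For all x, y, z ∈ ℝ², writing ΔD(p,q) = D(T(p),T(q)) − D(p,q), one has |ΔD(x,y) − ΔD(x,z)| ≤ (λ − 1)·D^u(z,y) + (1 − 1/λ)·D^s(z,y). In particular, if y and z range over a compact set, |ΔD(x,y) − ΔD(x,z)| is uniformly bounded over all x ∈ ℝ². -/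
open Set

/-- The translation `T(x, y) = (x + 1, y)`. -/
def Tr (p : ℝ × ℝ) : ℝ × ℝ := (p.1 + 1, p.2)

/-- `γ` is piecewise continuously differentiable on `[0,1]`: it is continuous on `[0,1]`
and there is a partition `0 = t₀ < t₁ < ⋯ < tₙ = 1` such that `γ` is `C¹` on each
subinterval `[tᵢ, tᵢ₊₁]`. -/
def IsPC1 (γ : ℝ → ℝ × ℝ) : Prop :=
  ContinuousOn γ (Icc 0 1) ∧
  ∃ (n : ℕ) (t : ℕ → ℝ), 0 < n ∧ t 0 = 0 ∧ t n = 1 ∧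
    (∀ i < n, t i < t (i + 1)) ∧
    ∀ i < n, ContDiffOn ℝ 1 γ (Icc (t i) (t (i + 1)))

/-- The stable length `∫₀¹ λ^(−γ₁(t)) |γ₁′(t)| dt` of a curve `γ`. -/
noncomputable def lenS (lam : ℝ) (γ : ℝ → ℝ × ℝ) : ℝ :=
  ∫ t in (0 : ℝ)..1, lam ^ (-(γ t).1) * |deriv (fun s => (γ s).1) t|

/-- The unstable length `∫₀¹ λ^(γ₁(t)) |γ₂′(t)| dt` of a curve `γ`. -/
noncomputable def lenU (lam : ℝ) (γ : ℝ → ℝ × ℝ) : ℝ :=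
  ∫ t in (0 : ℝ)..1, lam ^ ((γ t).1) * |deriv (fun s => (γ s).2) t|

/-- The stable pseudo-metric `D^s(p,q)`: the infimum of stable lengths of piecewise `C¹`
curves from `p` to `q`. -/
noncomputable def Ds (lam : ℝ) (p q : ℝ × ℝ) : ℝ :=
  sInf (lenS lam '' {γ | IsPC1 γ ∧ γ 0 = p ∧ γ 1 = q})

/-- The unstable pseudo-metric `D^u(p,q)`. -/
noncomputable def Du (lam : ℝ) (p q : ℝ × ℝ) : ℝ :=
  sInf (lenU lam '' {γ | IsPC1 γ ∧ γ 0 = p ∧ γ 1 = q})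

/-- `D = D^s + D^u`. -/
noncomputable def Dd (lam : ℝ) (p q : ℝ × ℝ) : ℝ :=
  Ds lam p q + Du lam p q

/-- The first difference of `D` along the translation `T`. -/
noncomputable def dD (lam : ℝ) (p q : ℝ × ℝ) : ℝ :=
  Dd lam (Tr p) (Tr q) - Dd lam p q

noncomputable def primS (lam u : ℝ) : ℝ := -(lam ^ (-u)) / Real.log lam

theorem primS_hasDerivAt {lam : ℝ} (hlam : 1 < lam) {f : ℝ → ℝ} {f' t : ℝ}
    (hf : HasDerivAt f f' t) :
    HasDerivAt (fun s => primS lam (f s)) (lam ^ (-(f t)) * f') t := by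
  have hL : Real.log lam ≠ 0 := (Real.log_pos hlam).ne'
  have h := ((hf.neg.const_rpow (by linarith : (0 : ℝ) < lam)).neg).div_const (Real.log lam)
  have e : lam ^ (-(f t)) * f' = -(Real.log lam * -f' * lam ^ (-f t)) / Real.log lam := by
    field_simp
  rw [e]
  exact h

theorem primS_cont {lam : ℝ} (hlam : 1 < lam) : Continuous (primS lam) := by
  unfold primS
  have : (lam : ℝ) ≠ 0 := by linarith
  have h : Continuous fun u : ℝ => lam ^ (-u) := by
    apply Continuous.rpow continuous_const continuous_neg
    intro x; exact Or.inl this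
  exact h.neg.div_const _

theorem piece {lam : ℝ} (hlam : 1 < lam) {f : ℝ → ℝ} {a b : ℝ} (hab : a < b)
    (hf : ContDiffOn ℝ 1 f (Icc a b)) :
    IntervalIntegrable (fun t => lam ^ (-(f t)) * deriv f t) MeasureTheory.volume a b ∧
    ∫ t in a..b, lam ^ (-(f t)) * deriv f t = primS lam (f b) - primS lam (f a) := by
  have hl0 : (lam : ℝ) ≠ 0 := by linarith
  have hint : IntervalIntegrable (fun t => lam ^ (-(f t)) * deriv f t)
      MeasureTheory.volume a b := by
    have h1 : ContinuousOn (fun t => lam ^ (-(f t)) * derivWithin f (Icc a b) t) (Icc a b) := by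
      apply ContinuousOn.mul
      · exact ContinuousOn.rpow continuousOn_const hf.continuousOn.neg
          (fun x _ => Or.inl hl0)
      · exact hf.continuousOn_derivWithin (uniqueDiffOn_Icc hab) le_rfl
    rw [← uIcc_of_le hab.le] at h1
    refine h1.intervalIntegrable.congr_uIoo ?_
    intro t ht
    rw [uIoo_of_le hab.le] at ht
    simp only [uIcc_of_le hab.le]
    rw [derivWithin_of_mem_nhds (Icc_mem_nhds ht.1 ht.2)]
  refine ⟨hint, ?_⟩
  refine intervalIntegral.integral_eq_sub_of_hasDerivAt_of_le
    (f := fun t => primS lam (f t)) hab.le ?_ ?_ hint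
  · exact (primS_cont hlam).comp_continuousOn hf.continuousOn
  · intro t ht
    apply primS_hasDerivAt hlam
    exact ((hf.differentiableOn (by norm_num)).differentiableAt
      (Icc_mem_nhds ht.1 ht.2)).hasDerivAt

theorem lenS_ge {lam : ℝ} (hlam : 1 < lam) {γ : ℝ → ℝ × ℝ} (h : IsPC1 γ) :
    |primS lam (γ 1).1 - primS lam (γ 0).1| ≤ lenS lam γ := by
  obtain ⟨-, n, t, -, h0, h1, hlt, hC⟩ := h
  have key : ∀ k ≤ n,
      IntervalIntegrable (fun s => lam ^ (-(γ s).1) * deriv (fun s => (γ s).1) s)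
        MeasureTheory.volume (t 0) (t k) ∧
      ∫ s in (t 0)..(t k), lam ^ (-(γ s).1) * deriv (fun s => (γ s).1) s
        = primS lam (γ (t k)).1 - primS lam (γ (t 0)).1 := by
    intro k
    induction k with
    | zero => intro _; simp
    | succ k ih =>
      intro hk
      obtain ⟨i1, i2⟩ := ih (by omega)
      obtain ⟨j1, j2⟩ := piece hlam (f := fun s => (γ s).1) (hlt k (by omega))
        (hC k (by omega)).fst
      refine ⟨i1.trans j1, ?_⟩
      rw [← intervalIntegral.integral_add_adjacent_intervals i1 j1, i2, j2]
      ring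
  obtain ⟨-, k2⟩ := key n le_rfl
  rw [h0, h1] at k2
  rw [← k2]
  refine (intervalIntegral.abs_integral_le_integral_abs zero_le_one).trans (le_of_eq ?_)
  unfold lenS
  congr 1
  ext s
  rw [abs_mul, abs_of_pos (Real.rpow_pos_of_pos (by linarith) _)]

theorem isPC1_of_smooth {γ : ℝ → ℝ × ℝ} (h : ContDiff ℝ 1 γ) : IsPC1 γ := by
  refine ⟨h.continuous.continuousOn, 1, fun i => i, one_pos, by simp, by simp, ?_, ?_⟩
  · intro i _; simp
  · intro i _; exact h.contDiffOn

theorem Ds_eq {lam : ℝ} (hlam : 1 < lam) (p q : ℝ × ℝ) :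
    Ds lam p q = |primS lam q.1 - primS lam p.1| := by
  apply le_antisymm
  · refine csInf_le ⟨0, ?_⟩ ⟨fun t => p + t • (q - p), ⟨?_, by simp, by simp⟩, ?_⟩
    · rintro _ ⟨γ, ⟨h, -, -⟩, rfl⟩
      exact (abs_nonneg _).trans (lenS_ge hlam h)
    · apply isPC1_of_smooth; fun_prop
    · have hd : ∀ t : ℝ, HasDerivAt (fun s : ℝ => p.1 + s * (q.1 - p.1)) (q.1 - p.1) t := by
        intro t
        simpa using ((hasDerivAt_id t).mul_const (q.1 - p.1)).const_add p.1
      have hP := (piece hlam (f := fun s : ℝ => p.1 + s * (q.1 - p.1)) zero_lt_one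
        (by apply ContDiff.contDiffOn; fun_prop)).2
      have hde : deriv (fun s : ℝ => p.1 + s * (q.1 - p.1)) = fun _ => q.1 - p.1 := by
        ext t; exact (hd t).deriv
      simp only [lenS, Prod.fst_add, Prod.smul_fst, Prod.fst_sub, smul_eq_mul]
      simp only [hde] at hP ⊢
      rw [intervalIntegral.integral_mul_const] at hP ⊢
      have h0 : 0 ≤ ∫ x in (0:ℝ)..1, lam ^ (-(p.1 + x * (q.1 - p.1))) := by
        apply intervalIntegral.integral_nonneg zero_le_one
        intro u _; exact Real.rpow_nonneg (by linarith) _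
      rw [← abs_of_nonneg h0, ← abs_mul, hP]
      simp
  · apply le_csInf
    · refine ⟨_, fun t => p + t • (q - p), ⟨?_, by simp, by simp⟩, rfl⟩
      apply isPC1_of_smooth; fun_prop
    · rintro _ ⟨γ, ⟨h, rfl, rfl⟩, rfl⟩
      exact lenS_ge hlam h

theorem Du_eq {lam : ℝ} (hlam : 1 < lam) (p q : ℝ × ℝ) : Du lam p q = 0 := by
  have hl0 : (0 : ℝ) < lam := by linarith
  have hnn : ∀ γ, 0 ≤ lenU lam γ := by
    intro γ
    apply intervalIntegral.integral_nonneg zero_le_one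
    intro u _
    exact mul_nonneg (Real.rpow_nonneg hl0.le _) (abs_nonneg _)
  let g : ℕ → ℝ → ℝ × ℝ := fun N t =>
    (p.1 + t * (q.1 - p.1) - N * (t * (1 - t)), p.2 + t * (q.2 - p.2))
  have hle : ∀ N, Du lam p q ≤ lenU lam (g N) := by
    intro N
    refine csInf_le ⟨0, ?_⟩ ⟨g N, ⟨?_, ?_, ?_⟩, rfl⟩
    · rintro _ ⟨γ, -, rfl⟩; exact hnn γ
    · apply isPC1_of_smooth; fun_prop
    · ext <;> simp [g]
    · ext <;> simp [g]
  have hlim : Filter.Tendsto (fun N => lenU lam (g N)) Filter.atTop (nhds 0) := by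
    have hde : deriv (fun s : ℝ => p.2 + s * (q.2 - p.2)) = fun _ => q.2 - p.2 := by
      ext t
      exact (by simpa using ((hasDerivAt_id t).mul_const (q.2 - p.2)).const_add p.2 :
        HasDerivAt (fun s : ℝ => p.2 + s * (q.2 - p.2)) (q.2 - p.2) t).deriv
    have hc : ∀ N : ℕ, Continuous fun t : ℝ =>
        lam ^ (p.1 + t * (q.1 - p.1) - N * (t * (1 - t))) := by
      intro N
      exact Continuous.rpow continuous_const (by fun_prop) (fun _ => Or.inl hl0.ne')
    have hc0 : Continuous fun t : ℝ => lam ^ (p.1 + t * (q.1 - p.1)) :=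
      Continuous.rpow continuous_const (by fun_prop) (fun _ => Or.inl hl0.ne')
    have hz : ∫ t in (0:ℝ)..1, (0:ℝ) = 0 := by simp
    simp only [lenU, g, hde]
    nth_rewrite 2 [← hz]
    apply intervalIntegral.tendsto_integral_filter_of_dominated_convergence
      (fun t => lam ^ (p.1 + t * (q.1 - p.1)) * |q.2 - p.2|)
    · refine Filter.Eventually.of_forall fun N => ?_
      exact ((hc N).mul continuous_const).aestronglyMeasurable
    · refine Filter.Eventually.of_forall fun N => Filter.Eventually.of_forall fun t ht => ?_
      rw [uIoc_of_le zero_le_one] at ht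
      rw [Real.norm_of_nonneg (mul_nonneg (Real.rpow_nonneg hl0.le _) (abs_nonneg _))]
      apply mul_le_mul_of_nonneg_right _ (abs_nonneg _)
      apply Real.rpow_le_rpow_of_exponent_le hlam.le
      have : 0 ≤ (N : ℝ) * (t * (1 - t)) :=
        mul_nonneg N.cast_nonneg (mul_nonneg ht.1.le (by linarith [ht.2]))
      linarith
    · exact (hc0.mul continuous_const).intervalIntegrable _ _
    · have hne : ∀ᵐ t : ℝ, t ≠ 1 := by
        simp [MeasureTheory.ae_iff]
      filter_upwards [hne] with t ht1 ht
      rw [uIoc_of_le zero_le_one] at ht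
      have hpos : 0 < t * (1 - t) :=
        mul_pos ht.1 (by have := lt_of_le_of_ne ht.2 ht1; linarith)
      rw [show (0:ℝ) = 0 * |q.2 - p.2| by simp]
      apply Filter.Tendsto.mul_const
      have h1 : Filter.Tendsto (fun N : ℕ => lam ^ (p.1 + t * (q.1 - p.1)) *
          ((lam ^ (-(t * (1 - t)))) ^ N)) Filter.atTop
          (nhds (lam ^ (p.1 + t * (q.1 - p.1)) * 0)) := by
        apply Filter.Tendsto.const_mul
        apply tendsto_pow_atTop_nhds_zero_of_lt_one (Real.rpow_nonneg hl0.le _)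
        exact Real.rpow_lt_one_of_one_lt_of_neg hlam (by linarith)
      rw [mul_zero] at h1
      refine h1.congr fun N => ?_
      rw [← Real.rpow_natCast, ← Real.rpow_mul hl0.le, ← Real.rpow_add hl0]
      congr 1
      ring
  apply le_antisymm
  · exact ge_of_tendsto' hlim hle
  · apply Real.sInf_nonneg
    rintro _ ⟨γ, -, rfl⟩
    exact hnn γ

theorem dD_eq {lam : ℝ} (hlam : 1 < lam) (p q : ℝ × ℝ) :
    dD lam p q = -((1 - 1 / lam) * |primS lam q.1 - primS lam p.1|) := by
  have hl0 : (0 : ℝ) < lam := by linarith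
  have hs : ∀ u, primS lam (u + 1) = 1 / lam * primS lam u := by
    intro u
    unfold primS
    rw [show -(u + 1) = -u + (-1) by ring, Real.rpow_add hl0, Real.rpow_neg_one]
    ring
  simp only [dD, Dd, Du_eq hlam, Ds_eq hlam, Tr, hs]
  rw [← mul_sub, abs_mul, abs_of_pos (by positivity : (0:ℝ) < 1 / lam)]
  ring

theorem main_ineq {lam : ℝ} (hlam : 1 < lam) (x y z : ℝ × ℝ) :
    |dD lam x y - dD lam x z| ≤ (1 - 1 / lam) * |primS lam y.1 - primS lam z.1| := by
  have hk : 0 ≤ 1 - 1 / lam := by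
    have : 1 / lam ≤ 1 := by rw [div_le_one (by linarith)]; exact hlam.le
    linarith
  rw [dD_eq hlam, dD_eq hlam, ← neg_sub', abs_neg, ← mul_sub, abs_mul, abs_of_nonneg hk]
  apply mul_le_mul_of_nonneg_left _ hk
  refine (abs_abs_sub_abs_le_abs_sub _ _).trans (le_of_eq ?_)
  congr 1
  ring

/-- `|ΔD(x,y) − ΔD(x,z)| ≤ (λ − 1)·D^u(z,y) + (1 − 1/λ)·D^s(z,y)`; in particular, when `y`
and `z` range over a compact set, `|ΔD(x,y) − ΔD(x,z)|` is uniformly bounded in `x`. -/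
theorem first_difference_uniformly_bounded (lam : ℝ) (hlam : 1 < lam) :
    (∀ x y z : ℝ × ℝ,
        |dD lam x y - dD lam x z| ≤ (lam - 1) * Du lam z y + (1 - 1 / lam) * Ds lam z y) ∧
    ∀ C : Set (ℝ × ℝ), IsCompact C → ∃ M : ℝ,
      ∀ x : ℝ × ℝ, ∀ y ∈ C, ∀ z ∈ C, |dD lam x y - dD lam x z| ≤ M := by
  refine ⟨fun x y z => ?_, fun C hC => ?_⟩
  · rw [Du_eq hlam, Ds_eq hlam, mul_zero, zero_add]
    exact main_ineq hlam x y z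
  · have hcont : ContinuousOn (fun w : (ℝ × ℝ) × (ℝ × ℝ) =>
        (1 - 1 / lam) * |primS lam w.1.1 - primS lam w.2.1|) (C ×ˢ C) := by
      have := primS_cont hlam
      apply Continuous.continuousOn
      fun_prop
    obtain ⟨M, hM⟩ := (hC.prod hC).exists_bound_of_continuousOn hcont
    refine ⟨M, fun x y hy z hz => ?_⟩
    exact (main_ineq hlam x y z).trans ((le_abs_self _).trans (hM (y, z) ⟨hy, hz⟩))
end
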